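/- Every planar graph is contained in H ⊠ P ⊠ K_3 for some planar graph H with treewidth at most 3 and for some path P. -/

import Mathlib

/-!
Common definitions: multigraphs, combinatorial (cellular) surface embeddings,
Euler genus, framed graphs, strong products, treewidth, partitions and layerings.
-/

/-- A multigraph on vertex type `V` with edge type `E`, given by its endpoints map. -/
structure Multigraph (V E : Type) where
  ends : E → Sym2 V

namespace Multigraph

variable {V E F : Type}

/-- The simple graph underlying a multigraph. -/
def simple (G : Multigraph V E) : SimpleGraph V where
  Adj u v := u ≠ v ∧ ∃ e, G.ends e = s(u, v)
  symm := by
    constructor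
    rintro u v ⟨hne, e, he⟩
    exact ⟨hne.symm, e, he.trans Sym2.eq_swap⟩
  loopless := by constructor; rintro u ⟨hne, -⟩; exact hne rfl

/-- The simple graph on `V` whose edges are the edges of `G` lying in `S`. -/
def simpleOn (G : Multigraph V E) (S : Set E) : SimpleGraph V where
  Adj u v := u ≠ v ∧ ∃ e ∈ S, G.ends e = s(u, v)
  symm := by
    constructor
    rintro u v ⟨hne, e, heS, he⟩
    exact ⟨hne.symm, e, heS, he.trans Sym2.eq_swap⟩
  loopless := by constructor; rintro u ⟨hne, -⟩; exact hne rfl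

/-- A multigraph is simple: no loops and no parallel edges. -/
def IsSimple (G : Multigraph V E) : Prop :=
  (∀ e, ¬ (G.ends e).IsDiag) ∧ Function.Injective G.ends

/-- A set `S` of edges of `G` forms a spanning tree of `G`. -/
def IsSpanningTree (G : Multigraph V E) (S : Set E) : Prop :=
  (G.simpleOn S).IsTree ∧ (∀ e ∈ S, ¬ (G.ends e).IsDiag) ∧
    ∀ e ∈ S, ∀ e' ∈ S, G.ends e = G.ends e' → e = e'

/-- A closed walk in a multigraph, recorded as periodic sequences of vertices and
edges: the walk visits `vtx 0, vtx 1, …, vtx (len - 1)` and returns to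
`vtx len = vtx 0`, traversing the edge `edge i` between `vtx i` and `vtx (i+1)`. -/
structure CWalk (G : Multigraph V E) where
  len : ℕ
  len_pos : 0 < len
  vtx : ℕ → V
  edge : ℕ → E
  vtx_per : ∀ i, vtx (i + len) = vtx i
  edge_per : ∀ i, edge (i + len) = edge i
  compat : ∀ i, G.ends (edge i) = s(vtx i, vtx (i + 1))

namespace CWalk

variable {G : Multigraph V E}

/-- The vertex `v` lies on the closed walk `W`. -/
def HasVtx (W : G.CWalk) (v : V) : Prop := ∃ i, i < W.len ∧ W.vtx i = v

/-- The edge `e` lies on the closed walk `W`. -/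
def HasEdge (W : G.CWalk) (e : E) : Prop := ∃ i, i < W.len ∧ W.edge i = e

/-- The closed walk `W` is a cycle: it repeats no vertex and no edge. -/
def IsCycle (W : G.CWalk) : Prop :=
  (∀ i j, i < W.len → j < W.len → W.vtx i = W.vtx j → i = j) ∧
  (∀ i j, i < W.len → j < W.len → W.edge i = W.edge j → i = j)

end CWalk

/-- `p = (f, i)` is an occurrence of the edge `e` in the family `bd` of closed walks:
the walk of face `f` traverses `e` at position `i`. -/
def IsOcc {G : Multigraph V E} (bd : F → G.CWalk) (e : E) (p : F × ℕ) : Prop :=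
  p.2 < (bd p.1).len ∧ (bd p.1).edge p.2 = e

/-- `c = (f, i)` is a corner of the vertex `v`: the walk of face `f` visits `v`
at position `i`. -/
def IsCorner {G : Multigraph V E} (bd : F → G.CWalk) (v : V) (c : F × ℕ) : Prop :=
  c.2 < (bd c.1).len ∧ (bd c.1).vtx c.2 = v

/-- The corner `c` is one of the two end corners of the edge occurrence `p`. -/
def EndOf {G : Multigraph V E} (bd : F → G.CWalk) (c p : F × ℕ) : Prop :=
  c.1 = p.1 ∧ (c.2 = p.2 ∨ c.2 = (p.2 + 1) % (bd p.1).len)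

/-- Two corners of `v` are linked if they are end corners (at `v`) of the two
distinct occurrences of a common edge; this is the edge-to-edge gluing relation
around the vertex `v`. -/
def CornerLinked {G : Multigraph V E} (bd : F → G.CWalk) (v : V) (c c' : F × ℕ) : Prop :=
  IsCorner bd v c ∧ IsCorner bd v c' ∧
    ∃ (e : E) (p p' : F × ℕ), p ≠ p' ∧ IsOcc bd e p ∧ IsOcc bd e p' ∧
      EndOf bd c p ∧ EndOf bd c' p'

/-- A combinatorial (cellular) embedding of a connected multigraph `G` in a closed
surface, with face set `F`: every face is given by its closed boundary walk, every
edge of `G` is traversed exactly twice in total by the boundary walks, and the link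
of every vertex is connected (so the embedding is in a genuine surface, with no
pinch points). -/
structure Embedding (G : Multigraph V E) (F : Type) where
  boundary : F → G.CWalk
  conn : G.simple.Connected
  edge_twice : ∀ e : E, {p : F × ℕ | IsOcc boundary e p}.ncard = 2
  link_conn : ∀ (v : V) (c c' : F × ℕ), IsCorner boundary v c → IsCorner boundary v c' →
    Relation.EqvGen (CornerLinked boundary v) c c'

/-- The Euler genus `2 - (|V| - |E| + |F|)` of an embedding, via Euler's formula. -/
noncomputable def Embedding.eulerGenus {G : Multigraph V E} {F : Type}
    (_ : Embedding G F) : ℤ :=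
  2 - ((Nat.card V : ℤ) - Nat.card E + Nat.card F)

/-- The simple graph underlying the framed multigraph `G^{(d)}`: two distinct
vertices are adjacent iff they are joined by an edge of `G` or lie on a common
face of length at most `d` (in which case `G^{(d)}` has a chord between them). -/
def framedGraph {G : Multigraph V E} {F : Type} (emb : Embedding G F) (d : ℕ) :
    SimpleGraph V where
  Adj u v := u ≠ v ∧ ((∃ e, G.ends e = s(u, v)) ∨
    ∃ f, (emb.boundary f).len ≤ d ∧ (emb.boundary f).HasVtx u ∧ (emb.boundary f).HasVtx v)
  symm := by
    constructor
    rintro u v ⟨hne, (⟨e, he⟩ | ⟨f, h1, h2, h3⟩)⟩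
    · exact ⟨hne.symm, Or.inl ⟨e, he.trans Sym2.eq_swap⟩⟩
    · exact ⟨hne.symm, Or.inr ⟨f, h1, h3, h2⟩⟩
  loopless := by constructor; rintro u ⟨hne, -⟩; exact hne rfl

end Multigraph

namespace SimpleGraph

/-- `G` is contained in `X`: `G` is isomorphic to a subgraph of `X`. -/
def IsContainedIn {α β : Type} (G : SimpleGraph α) (X : SimpleGraph β) : Prop :=
  ∃ f : G →g X, Function.Injective f

/-- The strong product of two simple graphs. -/
def strongProd {α β : Type} (G : SimpleGraph α) (H : SimpleGraph β) :
    SimpleGraph (α × β) where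
  Adj x y := x ≠ y ∧ (x.1 = y.1 ∨ G.Adj x.1 y.1) ∧ (x.2 = y.2 ∨ H.Adj x.2 y.2)
  symm := by
    constructor
    rintro x y ⟨hne, h1, h2⟩
    exact ⟨hne.symm, h1.imp Eq.symm (fun h => G.adj_symm h), h2.imp Eq.symm (fun h => H.adj_symm h)⟩
  loopless := by constructor; rintro x ⟨hne, -⟩; exact hne rfl

end SimpleGraph

/-- `G` has treewidth at most `k`: it has a tree-decomposition with all bags of
size at most `k + 1`. -/
def TreewidthLE {α : Type} (G : SimpleGraph α) (k : ℕ) : Prop :=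
  ∃ (ι : Type) (T : SimpleGraph ι) (B : ι → Set α),
    T.IsTree ∧
    (∀ v, ∃ i, v ∈ B i) ∧
    (∀ u v, G.Adj u v → ∃ i, u ∈ B i ∧ v ∈ B i) ∧
    (∀ v, (T.induce {i | v ∈ B i}).Connected) ∧
    ∀ i, (B i).encard ≤ (k : ℕ∞) + 1

/-- `G` has Euler genus at most `g`: `G` is (isomorphic to) a subgraph of a
multigraph having a combinatorial embedding of Euler genus at most `g`. -/
def HasEulerGenusLE {α : Type} (G : SimpleGraph α) (g : ℕ) : Prop :=
  ∃ (V' E' F' : Type), Finite V' ∧ Finite E' ∧ Finite F' ∧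
    ∃ (M : Multigraph V' E') (emb : M.Embedding F'),
      emb.eulerGenus ≤ (g : ℤ) ∧ G.IsContainedIn M.simple

/-- A planar graph: a graph of Euler genus `0`. -/
def IsPlanar {α : Type} (G : SimpleGraph α) : Prop := HasEulerGenusLE G 0

/-- An apex graph: deleting some vertex leaves a planar graph. -/
def IsApex {α : Type} (G : SimpleGraph α) : Prop :=
  ∃ v : α, IsPlanar (G.induce {w | w ≠ v})

/-- `A` indexes a partition of the vertices of `G` into nonempty parts `A x`, and the
quotient of `G` by this partition is (isomorphic to) `H`, via the indexing: this is an
`H`-partition of `G`. -/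
def IsHPartition {α W : Type} (G : SimpleGraph α) (H : SimpleGraph W) (A : W → Set α) : Prop :=
  (∀ x, (A x).Nonempty) ∧ (∀ v, ∃! x, v ∈ A x) ∧
    ∀ x y, x ≠ y → (H.Adj x y ↔ ∃ u ∈ A x, ∃ v ∈ A y, G.Adj u v)

/-- `(L 0, L 1, …)` is a layering of `G`: an ordered partition of the vertices such
that every edge joins vertices in the same or in consecutive layers. -/
def IsLayering {α : Type} (G : SimpleGraph α) (L : ℕ → Set α) : Prop :=
  (∀ v, ∃! j, v ∈ L j) ∧
    ∀ u v, G.Adj u v → ∀ i j, u ∈ L i → v ∈ L j → i ≤ j + 1 ∧ j ≤ i + 1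

/-- `b` lies on every walk from `a` to `c` in `T` (for a tree: `b` is on the unique
`a`–`c` path). -/
def BtwIn {α : Type} (T : SimpleGraph α) (a b c : α) : Prop :=
  ∀ p : T.Walk a c, b ∈ p.support

/-- `Q` is the vertex set of a vertical path in the tree `T` rooted at `r` with upper
end `w` and lower end `u`: `w` lies on the path from `r` to `u`, and `Q` is the set of
vertices of the `w`–`u` path. -/
def IsVerticalPathBtw {α : Type} (T : SimpleGraph α) (r : α) (Q : Set α) (w u : α) : Prop :=
  BtwIn T r w u ∧ Q = {x | BtwIn T w x u}

/-- `Q` is the vertex set of a vertical path in the tree `T` rooted at `r`. -/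
def IsVerticalPath {α : Type} (T : SimpleGraph α) (r : α) (Q : Set α) : Prop :=
  ∃ w u, IsVerticalPathBtw T r Q w u

/-- `Y` is the union of at most `k` vertical paths in the tree `T` rooted at `r`. -/
def IsUnionOfVPaths {α : Type} (T : SimpleGraph α) (r : α) (k : ℕ) (Y : Set α) : Prop :=
  ∃ m, m ≤ k ∧ ∃ Q : Fin m → Set α, (∀ i, IsVerticalPath T r (Q i)) ∧ Y = ⋃ i, Q i

namespace PPS

/-- triangle system -/
structure TS (W E F : Type) where
  M : Multigraph W E
  vt : F × Fin 3 → W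
  ed : F × Fin 3 → E
  compat : ∀ f i, M.ends (ed (f, i)) = s(vt (f, i), vt (f, i + 1))
  twice : ∀ e, ∃ p p' : F × Fin 3, p ≠ p' ∧ ∀ q, ed q = e ↔ q = p ∨ q = p'

def EndC {F : Type} (c p : F × Fin 3) : Prop := c.1 = p.1 ∧ (c.2 = p.2 ∨ c.2 = p.2 + 1)

def Lk {W E F : Type} (T : TS W E F) (c c' : F × Fin 3) : Prop :=
  T.vt c = T.vt c' ∧ ∃ p p', p ≠ p' ∧ T.ed p = T.ed p' ∧ EndC c p ∧ EndC c' p'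

def HasTD {W F : Type} (vt : F × Fin 3 → W) : Prop :=
  ∃ (ι : Type) (_ : Finite ι) (r : ι) (par : ι → ι) (rk : ι → ℕ) (b : ι → Fin 4 → W),
    (∀ i, i ≠ r → rk (par i) < rk i) ∧
    (∀ v, ∃ t, v ∈ Set.range (b t) ∧
      ∀ i, v ∈ Set.range (b i) → i ≠ t → i ≠ r ∧ v ∈ Set.range (b (par i))) ∧
    (∀ f, ∃ i, ∀ j, vt (f, j) ∈ Set.range (b i))

structure TS.Good {W E F : Type} (T : TS W E F) : Prop where
  link : ∀ c c', T.vt c = T.vt c' → Relation.EqvGen (Lk T) c c'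
  conn : T.M.simple.Connected
  euler : Nat.card W + Nat.card F = Nat.card E + 2
  td : HasTD T.vt

section cone
variable {W E F : Type} (T : TS W E F)

def coneEnds : E ⊕ (F × Fin 3) → Sym2 (W ⊕ F)
  | .inl e => (T.M.ends e).map Sum.inl
  | .inr p => s(Sum.inl (T.vt p), Sum.inr p.1)

def coneVt (c : (F × Fin 3) × Fin 3) : W ⊕ F :=
  (![Sum.inl (T.vt c.1), Sum.inl (T.vt (c.1.1, c.1.2 + 1)), Sum.inr c.1.1] : Fin 3 → W ⊕ F) c.2

def coneEd (c : (F × Fin 3) × Fin 3) : E ⊕ (F × Fin 3) :=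
  (![Sum.inl (T.ed c.1), Sum.inr (c.1.1, c.1.2 + 1), Sum.inr c.1] : Fin 3 → E ⊕ (F × Fin 3)) c.2

def cone : TS (W ⊕ F) (E ⊕ (F × Fin 3)) (F × Fin 3) where
  M := ⟨coneEnds T⟩
  vt := coneVt T
  ed := coneEd T
  compat := by
    rintro ⟨f, m⟩ i
    fin_cases i
    · simp [coneEd, coneVt, coneEnds, T.compat]
    · simp [coneEd, coneVt, coneEnds]
    · simp [coneEd, coneVt, coneEnds, Sym2.eq_swap]
  twice := by
    rintro (e | ⟨f, i⟩)
    · obtain ⟨p, p', hne, h⟩ := T.twice e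
      refine ⟨(p, 0), (p', 0), by simp [hne], ?_⟩
      rintro ⟨q, i⟩
      fin_cases i <;> simp [coneEd, h]
    · refine ⟨((f, i + 2), 1), ((f, i), 2), by simp, ?_⟩
      rintro ⟨⟨g, m⟩, j⟩
      fin_cases j
      · simp [coneEd]
      · simp [coneEd]
        intro _
        revert m i; decide
      · simp [coneEd]

theorem cone_lk_apex (f : F) (m : Fin 3) : Lk (cone T) ((f, m), 2) ((f, m + 1), 2) := by
  refine ⟨by simp [cone, coneVt], ((f, m), 1), ((f, m + 1), 2), by simp, by simp [cone, coneEd], ?_, ?_⟩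
  · exact ⟨rfl, Or.inr (by simp)⟩
  · exact ⟨rfl, Or.inl rfl⟩

theorem cone_lk_base (f : F) (m : Fin 3) : Lk (cone T) ((f, m), 1) ((f, m + 1), 0) := by
  refine ⟨by simp [cone, coneVt], ((f, m), 1), ((f, m + 1), 2), by simp, by simp [cone, coneEd], ?_, ?_⟩
  · exact ⟨rfl, Or.inl rfl⟩
  · exact ⟨rfl, Or.inr (by simp)⟩

theorem cone_end {c p : F × Fin 3} (h : EndC c p) :
    ∃ d, EndC d (p, (0 : Fin 3)) ∧ Relation.EqvGen (Lk (cone T)) (c, 0) d ∧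
      (cone T).vt d = Sum.inl (T.vt c) := by
  obtain ⟨f, i⟩ := c
  obtain ⟨g, m⟩ := p
  obtain ⟨h1, h2⟩ := h
  simp only at h1 h2
  subst h1
  rcases h2 with rfl | rfl
  · exact ⟨((f, i), 0), ⟨rfl, Or.inl rfl⟩, Relation.EqvGen.refl _, by simp [cone, coneVt]⟩
  · exact ⟨((f, m), 1), ⟨rfl, Or.inr rfl⟩,
      Relation.EqvGen.symm _ _ (Relation.EqvGen.rel _ _ (cone_lk_base T f m)), by simp [cone, coneVt]⟩

theorem cone_eqv {c c' : F × Fin 3} (h : Relation.EqvGen (Lk T) c c') :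
    Relation.EqvGen (Lk (cone T)) (c, 0) (c', 0) := by
  induction h with
  | rel x y h =>
    obtain ⟨hv, p, p', hne, he, h1, h2⟩ := h
    obtain ⟨d, hd, hd2, hd3⟩ := cone_end T h1
    obtain ⟨d', hd', hd2', hd3'⟩ := cone_end T h2
    refine hd2.trans _ _ _ (Relation.EqvGen.trans _ _ _ ?_ (hd2'.symm _ _))
    refine Relation.EqvGen.rel _ _ ⟨by rw [hd3, hd3', hv], (p, 0), (p', 0), by simp [hne], ?_, hd, hd'⟩
    simp [cone, coneEd, he]
  | refl x => exact .refl _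
  | symm x y _ ih => exact ih.symm
  | trans x y z _ _ ih1 ih2 => exact ih1.trans _ _ _ ih2

theorem cone_link (hl : ∀ c c', T.vt c = T.vt c' → Relation.EqvGen (Lk T) c c')
    (c c') (h : (cone T).vt c = (cone T).vt c') : Relation.EqvGen (Lk (cone T)) c c' := by
  have key : ∀ c w, (cone T).vt c = Sum.inl w → ∃ d, T.vt d = w ∧ Relation.EqvGen (Lk (cone T)) c (d, 0) := by
    rintro ⟨⟨f, m⟩, i⟩ w h
    fin_cases i
    · exact ⟨(f, m), by simpa [cone, coneVt] using h, .refl _⟩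
    · exact ⟨(f, m+1), by simpa [cone, coneVt] using h, .rel _ _ (cone_lk_base T f m)⟩
    · simp [cone, coneVt] at h
  have key2 : ∀ c f, (cone T).vt c = Sum.inr f → Relation.EqvGen (Lk (cone T)) c ((f, 0), 2) := by
    rintro ⟨⟨f, m⟩, i⟩ g h
    fin_cases i
    · simp [cone, coneVt] at h
    · simp [cone, coneVt] at h
    · simp [cone, coneVt] at h
      subst h
      have h0 := Relation.EqvGen.rel _ _ (cone_lk_apex T f 0)
      have h1 := Relation.EqvGen.rel _ _ (cone_lk_apex T f 1)
      fin_cases m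
      · exact .refl _
      · exact h0.symm
      · exact (h0.trans _ _ _ h1).symm
  rcases hw : (cone T).vt c with w | f
  · obtain ⟨d, hd, hd2⟩ := key c w hw
    obtain ⟨d', hd', hd2'⟩ := key c' w (by rw [← h, hw])
    exact hd2.trans _ _ _ ((cone_eqv T (hl d d' (by rw [hd, hd']))).trans _ _ _ (hd2'.symm))
  · exact (key2 c f hw).trans _ _ _ (key2 c' f (by rw [← h, hw])).symm

theorem cone_adj_inl {u v : W} (h : T.M.simple.Adj u v) :
    (cone T).M.simple.Adj (Sum.inl u) (Sum.inl v) := by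
  obtain ⟨hne, e, he⟩ := h
  exact ⟨by simpa using hne, Sum.inl e, by simp [cone, coneEnds, he]⟩

theorem cone_adj_inr (f : F) (i : Fin 3) :
    (cone T).M.simple.Adj (Sum.inl (T.vt (f, i))) (Sum.inr f) :=
  ⟨by simp, Sum.inr (f, i), by simp [cone, coneEnds]⟩

theorem cone_conn (h : T.M.simple.Connected) : (cone T).M.simple.Connected := by
  have hom : T.M.simple →g (cone T).M.simple := ⟨Sum.inl, fun h => cone_adj_inl T h⟩
  obtain ⟨w0⟩ := h.nonempty
  have key : ∀ w : W, (cone T).M.simple.Reachable (Sum.inl w) (Sum.inl w0) := by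
    intro w
    obtain ⟨p⟩ := h.preconnected w w0
    induction p with
    | nil => exact .rfl
    | cons ha _ ih => exact (cone_adj_inl T ha).reachable.trans ih
  have key2 : ∀ x : W ⊕ F, (cone T).M.simple.Reachable x (Sum.inl w0) := by
    rintro (w | f)
    · exact key w
    · exact (cone_adj_inr T f 0).symm.reachable.trans (key _)
  have : Nonempty (W ⊕ F) := ⟨Sum.inl w0⟩
  exact ⟨fun x y => (key2 x).trans (key2 y).symm⟩

theorem cone_td [Finite F] (h : HasTD T.vt) : HasTD (cone T).vt := by
  obtain ⟨ι, hfin, r, par, rk, b, hrk, htop, hf⟩ := h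
  choose i hi using hf
  let b' : ι ⊕ F → Fin 4 → W ⊕ F := fun x => match x with
    | .inl j => fun k => Sum.inl (b j k)
    | .inr f => ![Sum.inl (T.vt (f, 0)), Sum.inl (T.vt (f, 1)), Sum.inl (T.vt (f, 2)), Sum.inr f]
  refine ⟨ι ⊕ F, inferInstance, Sum.inl r, fun x => match x with
    | .inl j => Sum.inl (par j)
    | .inr f => Sum.inl (i f), fun x => match x with
    | .inl j => rk j
    | .inr f => rk (i f) + 1, b', ?_, ?_, ?_⟩
  · rintro (j | f) h
    · exact hrk j (by simpa using h)
    · simp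
  · have hb : ∀ w j, (Sum.inl w : W ⊕ F) ∈ Set.range (b' (.inl j)) ↔ w ∈ Set.range (b j) := by
      intro w j; simp [b']
    have hb2 : ∀ w f, (Sum.inl w : W ⊕ F) ∈ Set.range (b' (.inr f)) → ∃ j, T.vt (f, j) = w := by
      rintro w f ⟨k, hk⟩
      fin_cases k
      · exact ⟨0, by simpa [b'] using hk⟩
      · exact ⟨1, by simpa [b'] using hk⟩
      · exact ⟨2, by simpa [b'] using hk⟩
      · simp [b'] at hk
    rintro (w | f)
    · obtain ⟨t, ht, ht2⟩ := htop w
      refine ⟨Sum.inl t, (hb _ _).2 ht, ?_⟩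
      rintro (j | f) hj hne
      · have := ht2 j ((hb _ _).1 hj) (by simpa using hne)
        exact ⟨by simpa using this.1, (hb _ _).2 this.2⟩
      · refine ⟨by simp, ?_⟩
        obtain ⟨k, hk⟩ := hb2 _ _ hj
        exact (hb _ _).2 (hk ▸ hi f k)
    · refine ⟨Sum.inr f, ⟨3, by simp [b']⟩, ?_⟩
      rintro (j | g) hj hne
      · simp [b'] at hj
      · exfalso
        obtain ⟨k, hk⟩ := hj
        apply hne
        fin_cases k <;> simp [b'] at hk
        rw [hk]
  · rintro ⟨f, m⟩
    have hv : ∀ k, (Sum.inl (T.vt (f, k)) : W ⊕ F) ∈ Set.range (b' (Sum.inr f)) := by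
      intro k
      fin_cases k
      · exact ⟨0, by simp [b']⟩
      · exact ⟨1, by simp [b']⟩
      · exact ⟨2, by simp [b']⟩
    refine ⟨Sum.inr f, fun j => ?_⟩
    fin_cases j
    · exact hv m
    · exact hv (m+1)
    · exact ⟨3, by simp [b', cone, coneVt]⟩

theorem cone_good [Finite W] [Finite E] [Finite F] (h : T.Good) : (cone T).Good where
  link := cone_link T h.link
  conn := cone_conn T h.conn
  euler := by
    have := h.euler
    simp [Nat.card_sum, Nat.card_prod]
    omega
  td := cone_td T h.td

end cone

def baseTS : TS (Fin 3) (Fin 3) Bool where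
  M := ⟨fun i => s(i, i + 1)⟩
  vt := fun c => c.2
  ed := fun c => c.2
  compat := by intro f i; rfl
  twice := by
    intro e
    refine ⟨(false, e), (true, e), by simp, ?_⟩
    rintro ⟨b, q⟩
    cases b <;> simp

theorem base_good : baseTS.Good where
  link := by
    have key : ∀ i, Relation.EqvGen (Lk baseTS) (false, i) (true, i) := fun i =>
      .rel _ _ ⟨rfl, (false, i), (true, i), by simp, rfl, ⟨rfl, Or.inl rfl⟩, ⟨rfl, Or.inl rfl⟩⟩
    rintro ⟨b, i⟩ ⟨b', i'⟩ h
    change i = i' at h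
    subst h
    cases b <;> cases b'
    · exact .refl _
    · exact key i
    · exact (key i).symm
    · exact .refl _
  conn := by
    have h : ∀ i : Fin 3, i ≠ 0 → baseTS.M.simple.Adj i 0 := by
      intro i hi
      refine ⟨hi, ?_⟩
      fin_cases i
      · exact absurd rfl hi
      · exact ⟨0, Sym2.eq_swap⟩
      · exact ⟨2, rfl⟩
    have h2 : ∀ i : Fin 3, baseTS.M.simple.Reachable i 0 := by
      intro i
      by_cases hi : i = 0
      · subst hi; exact .rfl
      · exact (h i hi).reachable
    exact ⟨fun x y => (h2 x).trans (h2 y).symm⟩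
  euler := by simp
  td := by
    refine ⟨Unit, inferInstance, (), id, fun _ => 0, fun _ => ![0, 1, 2, 2], by simp, ?_, ?_⟩
    · intro v
      refine ⟨(), ?_, by simp⟩
      fin_cases v
      · exact ⟨0, rfl⟩
      · exact ⟨1, rfl⟩
      · exact ⟨2, rfl⟩
    · intro f
      refine ⟨(), fun v => ?_⟩
      change v ∈ _
      fin_cases v
      · exact ⟨0, rfl⟩
      · exact ⟨1, rfl⟩
      · exact ⟨2, rfl⟩

section conv
variable {W E F : Type} (T : TS W E F)

theorem ts_tw (h : T.Good) : TreewidthLE T.M.simple 3 := by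
  obtain ⟨ι, hfin, r, par, rk, b, hrk, htop, hf⟩ := h.td
  let G : SimpleGraph ι :=
    { Adj := fun i j => (i ≠ r ∧ par i = j) ∨ (j ≠ r ∧ par j = i)
      symm := ⟨fun i j h => h.symm⟩
      loopless := ⟨fun i h => by
        have : i ≠ r ∧ par i = i := by simpa using h
        have h2 := hrk i this.1
        rw [this.2] at h2
        exact lt_irrefl _ h2⟩ }
  refine ⟨ι, G, fun i => Set.range (b i), ?_, ?_, ?_, ?_, ?_⟩
  · rw [SimpleGraph.isTree_iff_connected_and_card]
    constructor
    · have : ∀ n i, rk i ≤ n → G.Reachable i r := by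
        intro n
        induction n with
        | zero =>
          intro i hi
          by_cases hir : i = r
          · subst hir; exact .rfl
          · have := hrk i hir; omega
        | succ n ih =>
          intro i hi
          by_cases hir : i = r
          · subst hir; exact .rfl
          · have h1 := hrk i hir
            have : G.Adj i (par i) := Or.inl ⟨hir, rfl⟩
            exact this.reachable.trans (ih _ (by omega))
      have hne : Nonempty ι := ⟨r⟩
      exact ⟨fun x y => (this _ x le_rfl).trans (this _ y le_rfl).symm⟩
    · have e : {i // i ≠ r} ≃ G.edgeSet := by
        refine Equiv.ofBijective (fun i => ⟨s(i.1, par i.1), Or.inl ⟨i.2, rfl⟩⟩) ⟨?_, ?_⟩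
        · rintro ⟨i, hi⟩ ⟨j, hj⟩ hij
          have hij := Sym2.eq_iff.1 (congrArg Subtype.val hij)
          simp only at hij
          rcases hij with h | ⟨h1, h2⟩
          · exact Subtype.ext h.1
          · exfalso
            have a := hrk i hi
            have c := hrk j hj
            rw [h2] at a
            rw [← h1] at c
            omega
        · rintro ⟨x, hx⟩
          induction x using Sym2.ind with
          | _ x y =>
          rcases hx with ⟨h1, h2⟩ | ⟨h1, h2⟩
          · exact ⟨⟨x, h1⟩, by simp [h2]⟩
          · exact ⟨⟨y, h1⟩, by simp [h2, Sym2.eq_swap]⟩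
      rw [← Nat.card_congr e]
      classical
      have := Fintype.ofFinite ι
      have : Nonempty ι := ⟨r⟩
      have : 0 < Fintype.card ι := Fintype.card_pos
      simp
      omega
  · intro v
    obtain ⟨t, ht, _⟩ := htop v
    exact ⟨t, ht⟩
  · rintro u v ⟨hne, e, he⟩
    obtain ⟨⟨f, m⟩, p', -, h⟩ := T.twice e
    have h1 := (h (f, m)).2 (Or.inl rfl)
    have h2 := T.compat f m
    rw [h1, he, Sym2.eq_iff] at h2
    obtain ⟨i, hi⟩ := hf f
    refine ⟨i, ?_⟩
    rcases h2 with ⟨rfl, rfl⟩ | ⟨rfl, rfl⟩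
    · exact ⟨hi _, hi _⟩
    · exact ⟨hi _, hi _⟩
  · intro v
    obtain ⟨t, ht, ht2⟩ := htop v
    have : ∀ n (i : {i | v ∈ Set.range (b i)}), rk i.1 ≤ n →
        (G.induce {i | v ∈ Set.range (b i)}).Reachable i ⟨t, ht⟩ := by
      intro n
      induction n with
      | zero =>
        rintro ⟨i, hv⟩ hi
        by_cases hir : i = t
        · subst hir; exact .rfl
        · have h1 := ht2 i hv hir
          have h2 := hrk i h1.1
          simp at hi; omega
      | succ n ih =>
        rintro ⟨i, hv⟩ hi
        by_cases hir : i = t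
        · subst hir; exact .rfl
        · have h1 := ht2 i hv hir
          have h2 := hrk i h1.1
          have : (G.induce {i | v ∈ Set.range (b i)}).Adj ⟨i, hv⟩ ⟨par i, h1.2⟩ := Or.inl ⟨h1.1, rfl⟩
          exact this.reachable.trans (ih _ (by simp at hi; simp; omega))
    have hne : Nonempty {i | v ∈ Set.range (b i)} := ⟨⟨t, ht⟩⟩
    exact ⟨fun x y => (this _ x le_rfl).trans (this _ y le_rfl).symm⟩
  · intro i
    change (Set.range (b i)).encard ≤ _
    rw [← Set.image_univ]
    refine (Set.encard_image_le _ _).trans ?_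
    rw [Set.encard_univ]
    simp
    norm_num

def toF (n : ℕ) : Fin 3 := Fin.ofNat 3 n

theorem toF_add3 (n : ℕ) : toF (n + 3) = toF n := by simp [toF, Fin.ofNat]
theorem toF_succ (n : ℕ) : toF (n + 1) = toF n + 1 := by
  apply Fin.ext; simp [toF, Fin.ofNat, Fin.val_add]
theorem toF_val (i : Fin 3) : toF i.val = i := by
  apply Fin.ext; simp [toF, Fin.ofNat]
theorem val_toF (n : ℕ) : (toF n).val = n % 3 := by simp [toF, Fin.ofNat]

def tsWalk (f : F) : T.M.CWalk where
  len := 3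
  len_pos := by norm_num
  vtx n := T.vt (f, toF n)
  edge n := T.ed (f, toF n)
  vtx_per i := by rw [toF_add3]
  edge_per i := by rw [toF_add3]
  compat i := by rw [T.compat, toF_succ]

def up (p : F × Fin 3) : F × ℕ := (p.1, p.2.val)

theorem up_inj : Function.Injective (up (F := F)) := by
  rintro ⟨f, i⟩ ⟨g, j⟩ h
  simp [up] at h
  exact Prod.ext h.1 (Fin.ext h.2)

theorem exists_up (q : F × ℕ) (h : q.2 < 3) : ∃ p, up p = q := ⟨(q.1, ⟨q.2, h⟩), rfl⟩

theorem occ_up (e : E) (q : F × Fin 3) : Multigraph.IsOcc (tsWalk T) e (up q) ↔ T.ed q = e := by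
  simp [Multigraph.IsOcc, tsWalk, up, toF_val]

theorem corner_up (e : W) (q : F × Fin 3) : Multigraph.IsCorner (tsWalk T) e (up q) ↔ T.vt q = e := by
  simp [Multigraph.IsCorner, tsWalk, up, toF_val]

theorem end_up {c p : F × Fin 3} (h : EndC c p) : Multigraph.EndOf (tsWalk T) (up c) (up p) := by
  obtain ⟨h1, h2⟩ := h
  refine ⟨h1, ?_⟩
  rcases h2 with h2 | h2
  · left; simp [up, h2]
  · right; simp [up, h2, tsWalk, Fin.val_add]

def tsEmb (h : T.Good) : T.M.Embedding F where
  boundary := tsWalk T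
  conn := h.conn
  edge_twice e := by
    obtain ⟨p, p', hne, hq⟩ := T.twice e
    have : {p : F × ℕ | Multigraph.IsOcc (tsWalk T) e p} = {up p, up p'} := by
      ext q
      simp only [Set.mem_ofPred_eq, Set.mem_insert_iff, Set.mem_singleton_iff]
      constructor
      · intro hh
        obtain ⟨q, rfl⟩ := exists_up q hh.1
        rw [occ_up, hq] at hh
        exact hh.imp (congrArg _) (congrArg _)
      · rintro (rfl | rfl)
        · rw [occ_up, hq]; exact Or.inl rfl
        · rw [occ_up, hq]; exact Or.inr rfl
    rw [this]
    exact Set.ncard_pair (fun h => hne (up_inj h))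
  link_conn v c c' hc hc' := by
    obtain ⟨c, rfl⟩ := exists_up c hc.1
    obtain ⟨c', rfl⟩ := exists_up c' hc'.1
    rw [corner_up] at hc hc'
    have := h.link c c' (by rw [hc, hc'])
    have key : ∀ c c', Relation.EqvGen (Lk T) c c' → (T.vt c = v ↔ T.vt c' = v) ∧
        (T.vt c = v → Relation.EqvGen (Multigraph.CornerLinked (tsWalk T) v) (up c) (up c')) := by
      intro c c' hh
      induction hh with
      | rel x y h =>
        obtain ⟨hv, p, p', hne, he, h1, h2⟩ := h
        refine ⟨by rw [hv], fun hx => .rel _ _ ⟨(corner_up _ _ _).2 hx, (corner_up _ _ _).2 (hv ▸ hx), T.ed p, up p, up p',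
          fun h => hne (up_inj h), (occ_up _ _ _).2 rfl, (occ_up _ _ _).2 he.symm, end_up T h1, end_up T h2⟩⟩
      | refl x => exact ⟨Iff.rfl, fun _ => .refl _⟩
      | symm x y _ ih => exact ⟨ih.1.symm, fun h => (ih.2 (ih.1.2 h)).symm⟩
      | trans x y z _ _ ih1 ih2 => exact ⟨ih1.1.trans ih2.1, fun h => (ih1.2 h).trans _ _ _ (ih2.2 (ih1.1.1 h))⟩
    exact (key c c' this).2 hc

theorem ts_planar [Finite W] [Finite E] [Finite F] (h : T.Good) : IsPlanar T.M.simple := by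
  refine ⟨W, E, F, inferInstance, inferInstance, inferInstance, T.M, tsEmb T h, ?_, ⟨SimpleGraph.Hom.id, Function.injective_id⟩⟩
  have := h.euler
  simp [Multigraph.Embedding.eulerGenus]
  omega
end conv
end PPS

namespace PPS
open List
variable {α : Type}

def NX (X : α → α → α → α → Prop) (l : List α) : Prop :=
  ∀ p q r s, [p, q, r, s] <+ l → ¬ X p q r s

theorem NX.sub {X : α → α → α → α → Prop} {l l' : List α} (h : NX X l) (hs : l' <+ l) : NX X l' :=
  fun p q r s hh => h p q r s (hh.trans hs)

theorem NX.rot {X : α → α → α → α → Prop} (hX : ∀ p q r s, X p q r s → X q r s p)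
    {l1 l2 : List α} (h : NX X (l1 ++ l2)) : NX X (l2 ++ l1) := by
  intro p q r s hs hx
  rw [List.sublist_append_iff] at hs
  obtain ⟨m1, m2, he, h1, h2⟩ := hs
  have h3 := h2.append h1
  have x1 := hX _ _ _ _ hx
  have x2 := hX _ _ _ _ x1
  have x3 := hX _ _ _ _ x2
  rcases m1 with _ | ⟨a, _ | ⟨b, _ | ⟨c, _ | ⟨d, _ | ⟨e, m⟩⟩⟩⟩⟩ <;> simp at he
  · subst he; exact h _ _ _ _ (by simpa using h3) hx
  · obtain ⟨rfl, rfl⟩ := he; exact h _ _ _ _ (by simpa using h3) x1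
  · obtain ⟨rfl, rfl, rfl⟩ := he; exact h _ _ _ _ (by simpa using h3) x2
  · obtain ⟨rfl, rfl, rfl, rfl⟩ := he; exact h _ _ _ _ (by simpa using h3) x3
  · obtain ⟨rfl, rfl, rfl, rfl, rfl⟩ := he; exact h _ _ _ _ (by simpa using h3) hx

theorem NX.four {X : α → α → α → α → Prop} {l l1 l2 l3 l4 : List α} (h : NX X l)
    (he : l = l1 ++ (l2 ++ (l3 ++ l4))) {p q r s : α} (hp : p ∈ l1) (hq : q ∈ l2) (hr : r ∈ l3) (hs : s ∈ l4) :
    ¬ X p q r s := by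
  apply h
  subst he
  exact (List.singleton_sublist.2 hp).append ((List.singleton_sublist.2 hq).append
    ((List.singleton_sublist.2 hr).append (List.singleton_sublist.2 hs)))

theorem furthest (P : α → Prop) : ∀ (O : List α), O ≠ [] →
    ∃ O1 k O2, O = O1 ++ k :: O2 ∧ (∀ q ∈ O2, ¬ P q) ∧ (O1 = [] ∨ P k) := by
  intro O
  induction O with
  | nil => simp
  | cons a O ih =>
    intro _
    by_cases h : ∃ q ∈ O, P q
    · obtain ⟨q, hq, hP⟩ := h
      obtain ⟨O1, k, O2, rfl, h1, h2⟩ := ih (List.ne_nil_of_mem hq)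
      refine ⟨a :: O1, k, O2, rfl, h1, Or.inr ?_⟩
      rcases h2 with rfl | h2
      · simp at hq
        rcases hq with rfl | hq
        · exact hP
        · exact absurd hP (h1 q hq)
      · exact h2
    · push Not at h
      exact ⟨[], a, O, rfl, h, Or.inl rfl⟩

def RX (R : α → α → Prop) (p q r s : α) : Prop := R p r ∧ R q s

def NoR (R : α → α → Prop) (l m : List α) : Prop := ∀ x ∈ l, ∀ y ∈ m, ¬ R x y

theorem NoR.symm {R : α → α → Prop} (hR : ∀ x y, R x y → R y x) {l m : List α} (h : NoR R l m) : NoR R m l :=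
  fun x hx y hy hxy => h y hy x hx (hR _ _ hxy)

structure PickP (R : α → α → Prop) (A B C A1 A2 ta B1 B2 tb C1 C2 tc : List α) : Prop where
  la : ta.length ≤ 1
  lb : tb.length ≤ 1
  lc : tc.length ≤ 1
  ea : A = A1 ++ ta ++ A2
  eb : B = B1 ++ tb ++ B2
  ec : C = C1 ++ tc ++ C2
  na : ta = [] → A = []
  nb : tb = [] → B = []
  nc : tc = [] → C = []
  x01 : NoR R (A2 ++ B1) (B2 ++ C1)
  x12 : NoR R (B2 ++ C1) (C2 ++ A1)
  x20 : NoR R (C2 ++ A1) (A2 ++ B1)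
  t0 : NoR R ta (B2 ++ C1)
  t1 : NoR R tb (C2 ++ A1)
  t2 : NoR R tc (A2 ++ B1)
  p0 : ta.length + A2.length + B1.length + tb.length < A.length + B.length + C.length
  p1 : tb.length + B2.length + C1.length + tc.length < A.length + B.length + C.length
  p2 : tc.length + C2.length + A1.length + ta.length < A.length + B.length + C.length

def Pick (R : α → α → Prop) (A B C : List α) : Prop :=
  ∃ A1 A2 ta B1 B2 tb C1 C2 tc, PickP R A B C A1 A2 ta B1 B2 tb C1 C2 tc

theorem Pick.rot {R : α → α → Prop} {A B C : List α} (h : Pick R A B C) : Pick R B C A := by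
  obtain ⟨A1, A2, ta, B1, B2, tb, C1, C2, tc, h⟩ := h
  refine ⟨B1, B2, tb, C1, C2, tc, A1, A2, ta, ?_⟩
  have h0 := h.p0
  have h1 := h.p1
  have h2 := h.p2
  exact ⟨h.lb, h.lc, h.la, h.eb, h.ec, h.ea, h.nb, h.nc, h.na, h.x12, h.x20, h.x01, h.t1, h.t2, h.t0,
    by omega, by omega, by omega⟩

section
variable {R : α → α → Prop}

theorem split_mid {X Y O1 O2 : List α} {k : α} (h : X ++ Y = O1 ++ k :: O2) :
    (∃ Z, X = O1 ++ k :: Z ∧ O2 = Z ++ Y) ∨ (∃ Z, O1 = X ++ Z ∧ Y = Z ++ k :: O2) := by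
  rw [List.append_eq_append_iff] at h
  rcases h with ⟨as, h1, h2⟩ | ⟨bs, h1, h2⟩
  · exact Or.inr ⟨as, h1, h2⟩
  · cases bs with
    | nil => right; exact ⟨[], by simp [h1], by simpa using h2.symm⟩
    | cons b bs =>
      simp at h2
      obtain ⟨rfl, rfl⟩ := h2
      exact Or.inl ⟨bs, h1, rfl⟩

theorem RX_rot (hR : ∀ x y, R x y → R y x) : ∀ p q r s, RX R p q r s → RX R q r s p := fun _ _ _ _ h => ⟨h.2, hR _ _ h.1⟩

theorem pick3aux (hR : ∀ x y, R x y → R y x) {B C : List α} (A : List α) (hC : C ≠ []) (h : NX (RX R) (A ++ (B ++ C))) :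
    ∀ n A1 i A2 B1 j B2, A = A1 ++ i :: A2 → B = B1 ++ j :: B2 →
      NoR R (A2 ++ B1) (B2 ++ (C ++ A1)) → A.length + B.length ≤ n + A2.length + B1.length →
      Pick R A B C := by
  intro n
  induction n with
  | zero =>
    intro A1 i A2 B1 j B2 hA hB _ hn
    subst hA hB
    simp at hn
    omega
  | succ n ih =>
    intro A1 i A2 B1 j B2 hA hB hno hn
    obtain ⟨O1, k, O2, hO, hf, hk⟩ := furthest (fun x => R j x) (B2 ++ (C ++ A1)) (by simp [hC])
    have h' : NX (RX R) ((B ++ C) ++ A) := h.rot (RX_rot hR)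
    have e' : (B ++ C) ++ A = B1 ++ j :: (O1 ++ k :: (O2 ++ i :: A2)) := by
      have : (B ++ C) ++ A = B1 ++ j :: ((B2 ++ (C ++ A1)) ++ i :: A2) := by
        subst hA hB; simp
      rw [this, hO]; simp
    have h'' : NX (RX R) (j :: (O1 ++ k :: (O2 ++ i :: A2))) := by
      apply h'.sub; rw [e']; simp
    -- O1 vs O2
    have c1 : ∀ x ∈ O1, ∀ y ∈ O2, ¬ R x y := by
      intro x hx y hy hxy
      rcases hk with rfl | hk
      · simp at hx
      · exact h''.four (l1 := [j]) (l2 := O1) (l3 := [k]) (l4 := O2 ++ i :: A2) (by simp) (by simp) hx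
          (by simp) (by simp [hy]) ⟨hk, hxy⟩
    have c2 : ∀ x ∈ O1, ¬ R i x := by
      intro x hx hxy
      rcases hk with rfl | hk
      · simp at hx
      · exact h''.four (l1 := [j]) (l2 := O1) (l3 := [k]) (l4 := O2 ++ i :: A2) (by simp) (by simp) hx
          (by simp) (by simp) ⟨hk, hR _ _ hxy⟩
    rcases split_mid hO with ⟨Z, rfl, rfl⟩ | ⟨Z, rfl, hO2⟩
    · -- k in B2
      refine ih A1 i A2 (B1 ++ j :: O1) k Z hA (by subst hB; simp) ?_ (by simp at hn ⊢; omega)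
      intro x hx y hy
      have hx : x ∈ A2 ++ B1 ∨ x = j ∨ x ∈ O1 := by simp at hx ⊢; tauto
      rcases hx with hx | rfl | hx
      · exact hno x hx y (by simp at hy ⊢; tauto)
      · exact hf y hy
      · exact c1 x hx y hy
    rcases split_mid hO2 with ⟨Y, hC', rfl⟩ | ⟨Y, rfl, rfl⟩
    · -- k in C
      refine ⟨A1, A2, [i], B1, B2, [j], Z, Y, [k], by simp, by simp, by simp, by simp [hA], by simp [hB], by simp [hC'],
        by simp, by simp, by simp, ?_, ?_, ?_, ?_, ?_, ?_, ?_, ?_, ?_⟩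
      · intro x hx y hy
        exact hno x hx y (by subst hC'; simp at hy ⊢; tauto)
      · exact c1
      · intro x hx y hy hxy
        exact hno y hy x (by subst hC'; simp at hx ⊢; tauto) (hR _ _ hxy)
      · intro x hx; simp at hx; subst hx; exact c2
      · intro x hx; simp at hx; subst hx; exact hf
      · intro x hx; simp at hx; subst hx
        intro y hy hxy
        exact hno y hy x (by subst hC'; simp) (hR _ _ hxy)
      · subst hA hB hC'; simp; omega
      · subst hA hB hC'; simp; omega
      · subst hA hB hC'; simp; omega
    · -- k in A1
      refine ih Y k (O2 ++ i :: A2) B1 j B2 (by simp [hA]) hB ?_ (by simp at hn ⊢; omega)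
      intro x hx y hy
      have hx : x ∈ A2 ++ B1 ∨ x = i ∨ x ∈ O2 := by simp at hx ⊢; tauto
      rcases hx with hx | rfl | hx
      · exact hno x hx y (by simp at hy ⊢; tauto)
      · exact c2 y hy
      · exact fun hxy => c1 y hy x hx (hR _ _ hxy)

theorem pick3 (hR : ∀ x y, R x y → R y x) {A B C : List α} (hA : A ≠ []) (hB : B ≠ []) (hC : C ≠ [])
    (h : NX (RX R) (A ++ (B ++ C))) : Pick R A B C := by
  obtain ⟨A', i, rfl⟩ : ∃ A' i, A = A' ++ [i] := ⟨A.dropLast, A.getLast hA, (List.dropLast_append_getLast hA).symm⟩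
  obtain ⟨j, B', rfl⟩ := List.exists_cons_of_ne_nil hB
  exact pick3aux hR _ hC h _ A' i [] [] j B' rfl rfl (by intro x hx; simp at hx) le_rfl

theorem pick2 (hR : ∀ x y, R x y → R y x) {s : α → Prop} (hs : ∀ x y, s x → s y → ¬ R x y)
    {i0 j0 : α} {A' B' : List α} (hi : s i0) (hj : s j0) (hne : A' ++ B' ≠ [])
    (h : NX (RX R) (i0 :: A' ++ (B' ++ [j0]))) : Pick R (i0 :: A') (B' ++ [j0]) [] := by
  obtain ⟨O1, k, O2, hO, hf, hk⟩ := furthest (fun x => R i0 x) (A' ++ B') hne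
  have e : i0 :: A' ++ (B' ++ [j0]) = i0 :: (O1 ++ k :: (O2 ++ [j0])) := by
    have : i0 :: A' ++ (B' ++ [j0]) = i0 :: ((A' ++ B') ++ [j0]) := by simp
    rw [this, hO]; simp
  rw [e] at h
  have c1 : NoR R O1 (O2 ++ [j0]) := by
    intro x hx y hy hxy
    rcases hk with rfl | hk
    · simp at hx
    · exact h.four (l1 := [i0]) (l2 := O1) (l3 := [k]) (l4 := O2 ++ [j0]) (by simp) (by simp) hx
        (by simp) hy ⟨hk, hxy⟩
  have c0 : NoR R [i0] (O2 ++ [j0]) := by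
    intro x hx y hy
    simp at hx hy
    subst hx
    rcases hy with hy | rfl
    · exact hf y hy
    · exact hs _ _ hi hj
  rcases split_mid hO with ⟨Z, rfl, rfl⟩ | ⟨Z, rfl, rfl⟩
  · refine ⟨i0 :: O1, Z, [k], B', [], [j0], [], [], [], by simp, by simp, by simp, by simp, by simp, by simp,
      by simp, by simp, by simp, ?_, ?_, ?_, ?_, ?_, ?_, ?_, ?_, ?_⟩
    · intro x _ y hy; simp at hy
    · intro x hx; simp at hx
    · intro x hx y hy
      simp at hx
      rcases hx with rfl | hx
      · exact c0 x (by simp) y (by simp at hy ⊢; tauto)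
      · exact c1 x hx y (by simp at hy ⊢; tauto)
    · intro x _ y hy; simp at hy
    · intro x hx y hy hxy
      simp at hx hy
      subst hx
      rcases hy with rfl | hy
      · exact hs _ _ hj hi hxy
      · exact c1 y hy x (by simp) (hR _ _ hxy)
    · intro x hx; simp at hx
    · simp
      omega
    · simp
      omega
    · simp
      omega
  · refine ⟨[], A', [i0], Z, O2 ++ [j0], [k], [], [], [], by simp, by simp, by simp, by simp, by simp, by simp,
      by simp, by simp, by simp, ?_, ?_, ?_, ?_, ?_, ?_, ?_, ?_, ?_⟩
    · simpa using c1
    · intro x _ y hy; simp at hy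
    · intro x hx; simp at hx
    · simpa using c0
    · intro x _ y hy; simp at hy
    · intro x hx; simp at hx
    · simp
      omega
    · simp
      omega
    · simp
      omega

theorem pick1 {s : α → Prop} (hs : ∀ x y, s x → s y → ¬ R x y)
    {i0 j0 : α} {O : List α} (hi : s i0) (hj : s j0) (hne : O ≠ [])
    (h : NX (RX R) (i0 :: (O ++ [j0]))) : Pick R (i0 :: (O ++ [j0])) [] [] := by
  obtain ⟨O1, k, O2, hO, hf, hk⟩ := furthest (fun x => R i0 x) O hne
  subst hO
  have c1 : NoR R O1 (O2 ++ [j0]) := by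
    intro x hx y hy hxy
    rcases hk with rfl | hk
    · simp at hx
    · exact h.four (l1 := [i0]) (l2 := O1) (l3 := [k]) (l4 := O2 ++ [j0]) (by simp) (by simp) hx
        (by simp) hy ⟨hk, hxy⟩
  have c0 : NoR R [i0] (O2 ++ [j0]) := by
    intro x hx y hy
    simp at hx hy
    subst hx
    rcases hy with hy | rfl
    · exact hf y hy
    · exact hs _ _ hi hj
  refine ⟨i0 :: O1, O2 ++ [j0], [k], [], [], [], [], [], [], by simp, by simp, by simp, by simp, by simp, by simp,
      by simp, by simp, by simp, ?_, ?_, ?_, ?_, ?_, ?_, ?_, ?_, ?_⟩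
  · intro x _ y hy; simp at hy
  · intro x hx; simp at hx
  · intro x hx y hy
    simp at hx
    rcases hx with rfl | hx
    · exact c0 x (by simp) y (by simpa using hy)
    · exact c1 x hx y (by simpa using hy)
  · intro x _ y hy; simp at hy
  · intro x hx; simp at hx
  · intro x hx; simp at hx
  · simp
    omega
  · simp
  · simp

/-- head and last in `s`. -/
def HL (s : α → Prop) (A : List α) : Prop := (∀ x ∈ A.head?, s x) ∧ (∀ x ∈ A.getLast?, s x)

theorem pick (hR : ∀ x y, R x y → R y x) {s : α → Prop} (hs : ∀ x y, s x → s y → ¬ R x y)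
    {A B C : List α} (hA : HL s A) (hB : HL s B) (hC : HL s C)
    (h : NX (RX R) (A ++ (B ++ C))) {u : α} (hu : ¬ s u) (huA : u ∈ A ++ (B ++ C)) : Pick R A B C := by
  have two : ∀ A B : List α, A ≠ [] → B ≠ [] → HL s A → HL s B → NX (RX R) (A ++ B) → u ∈ A ++ B → Pick R A B [] := by
    intro A B hA hB hsA hsB h hu'
    obtain ⟨B', j, rfl⟩ : ∃ A' i, B = A' ++ [i] := ⟨B.dropLast, B.getLast hB, (List.dropLast_append_getLast hB).symm⟩
    obtain ⟨i, A', rfl⟩ := List.exists_cons_of_ne_nil hA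
    have h1 : s i := hsA.1 i (by simp)
    have h2 : s j := hsB.2 j (by simp)
    refine pick2 hR hs h1 h2 ?_ h
    intro he
    simp at he
    obtain ⟨rfl, rfl⟩ := he
    simp at hu'
    rcases hu' with rfl | rfl
    · exact hu h1
    · exact hu h2
  have one : ∀ A : List α, HL s A → NX (RX R) A → u ∈ A → Pick R A [] [] := by
    intro A hsA h hu'
    obtain ⟨i, A', rfl⟩ := List.exists_cons_of_ne_nil (List.ne_nil_of_mem hu')
    have h1 : s i := hsA.1 i (by simp)
    have hA' : A' ≠ [] := by
      rintro rfl
      simp at hu'; subst hu'; exact hu h1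
    obtain ⟨B', j, rfl⟩ : ∃ A'' i, A' = A'' ++ [i] := ⟨A'.dropLast, A'.getLast hA', (List.dropLast_append_getLast hA').symm⟩
    have h2 : s j := hsA.2 j (by rw [Option.mem_def, ← List.cons_append, List.getLast?_concat])
    refine pick1 hs h1 h2 ?_ h
    rintro rfl
    simp at hu'
    rcases hu' with rfl | rfl
    · exact hu h1
    · exact hu h2
  by_cases a : A = [] <;> by_cases b : B = [] <;> by_cases c : C = []
  · subst a b c; simp at huA
  · subst a b; simp at huA h
    exact (one C hC h huA).rot
  · subst a c; simp at huA h
    exact (one B hB h huA).rot.rot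
  · subst a; simp only [List.nil_append] at huA h
    exact (two B C b c hB hC h huA).rot.rot
  · subst b c; simp at huA h
    exact one A hA h huA
  · subst b; simp only [List.nil_append] at huA h
    exact (two C A c a hC hA (h.rot (RX_rot hR)) (by simp at huA ⊢; tauto)).rot
  · subst c; simp only [List.append_nil] at huA h
    exact two A B a b hA hB h huA
  · exact pick3 hR a b c h
end
end PPS

namespace PPS
open List

structure Tour (V α : Type) where
  par : V → V
  dep : V → ℕ
  r : V
  vt : α → V
  C : α → α → Prop
  L0 : List α
  par_r : par r = r
  dep_r : dep r = 0
  dep_par : ∀ v, v ≠ r → dep (par v) + 1 = dep v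
  Csymm : ∀ x y, C x y → C y x

namespace Tour
variable {V α : Type} (T : Tour V α)

def Anc (t v : V) : Prop := ∃ n, T.par^[n] v = t

def Cross (p q r s : α) : Prop :=
  (T.C p r ∧ T.C q s) ∨ ∃ t,
    (T.Anc t (T.vt p) ∧ T.Anc t (T.vt r) ∧ ¬ T.Anc t (T.vt q) ∧ ¬ T.Anc t (T.vt s)) ∨
    (¬ T.Anc t (T.vt p) ∧ ¬ T.Anc t (T.vt r) ∧ T.Anc t (T.vt q) ∧ T.Anc t (T.vt s))

def link (p q : α) : Prop := T.vt p = T.vt q ∨ T.vt q = T.par (T.vt p) ∨ T.vt p = T.par (T.vt q)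

def lk (S : V → Prop) (p q : α) : Prop := T.link p q ∨ (S (T.vt p) ∧ S (T.vt q))

def Blk (S : V → Prop) (A : List α) : Prop := HL (fun p => S (T.vt p)) A ∧ List.IsChain (T.lk S) A

structure Good : Prop where
  nx : NX T.Cross T.L0
  chain : List.IsChain T.link T.L0
  cov : ∀ v, ∃ p ∈ T.L0, T.vt p = v

variable {T}

theorem anc_refl (v : V) : T.Anc v v := ⟨0, rfl⟩

theorem anc_trans {a b c : V} (h : T.Anc a b) (h' : T.Anc b c) : T.Anc a c := by
  obtain ⟨n, rfl⟩ := h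
  obtain ⟨m, rfl⟩ := h'
  exact ⟨n + m, by rw [Function.iterate_add_apply]⟩

theorem anc_par (v : V) : T.Anc (T.par v) v := ⟨1, rfl⟩

theorem anc_cases {t v : V} (h : T.Anc t v) : t = v ∨ T.Anc t (T.par v) := by
  obtain ⟨n, rfl⟩ := h
  cases n with
  | zero => left; rfl
  | succ n => right; exact ⟨n, rfl⟩

theorem dep_zero {v : V} (h : T.dep v = 0) : v = T.r := by
  by_contra hv
  have := T.dep_par v hv
  omega

theorem dep_iter (n : ℕ) (v : V) : T.dep (T.par^[n] v) = T.dep v - n := by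
  induction n generalizing v with
  | zero => rfl
  | succ n ih =>
    rw [Function.iterate_succ_apply, ih]
    by_cases hv : v = T.r
    · subst hv; rw [T.par_r, T.dep_r]; omega
    · have := T.dep_par v hv; omega

theorem anc_eq {u v w : V} (hu : T.Anc u w) (hv : T.Anc v w) (h : T.dep u = T.dep v) : u = v := by
  obtain ⟨n, rfl⟩ := hu
  obtain ⟨m, rfl⟩ := hv
  by_cases h0 : T.dep (T.par^[n] w) = 0
  · exact (dep_zero h0).trans (dep_zero (h.symm.trans h0)).symm
  · have h1 := dep_iter (T := T) n w
    have h2 := dep_iter (T := T) m w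
    have : n = m := by omega
    rw [this]

theorem up_anc {S : V → Prop} (hup : ∀ v, S v → S (T.par v)) {t v : V} (h : T.Anc t v) (hv : S v) : S t := by
  obtain ⟨n, rfl⟩ := h
  induction n generalizing v with
  | zero => exact hv
  | succ n ih => rw [Function.iterate_succ_apply]; exact ih (hup _ hv)

theorem cross_rot (p q r s : α) (h : T.Cross p q r s) : T.Cross q r s p := by
  rcases h with ⟨h1, h2⟩ | ⟨t, h | h⟩
  · exact Or.inl ⟨h2, T.Csymm _ _ h1⟩
  · exact Or.inr ⟨t, Or.inr ⟨h.2.2.1, h.2.2.2, h.2.1, h.1⟩⟩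
  · exact Or.inr ⟨t, Or.inl ⟨h.2.2.1, h.2.2.2, h.2.1, h.1⟩⟩

theorem cross_rev (p q r s : α) (h : T.Cross p q r s) : T.Cross s r q p := by
  rcases h with ⟨h1, h2⟩ | ⟨t, h | h⟩
  · exact Or.inl ⟨T.Csymm _ _ h2, T.Csymm _ _ h1⟩
  · exact Or.inr ⟨t, Or.inr ⟨h.2.2.2, h.2.2.1, h.2.1, h.1⟩⟩
  · exact Or.inr ⟨t, Or.inl ⟨h.2.2.2, h.2.2.1, h.2.1, h.1⟩⟩

theorem nx_rev {l : List α} (h : NX T.Cross l) : NX T.Cross l.reverse := by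
  intro p q r s hs hx
  have := hs.reverse
  simp at this
  exact h _ _ _ _ this (cross_rev _ _ _ _ hx)

theorem lk_symm {S : V → Prop} {p q : α} (h : T.lk S p q) : T.lk S q p := by
  rcases h with (h | h | h) | h
  · exact Or.inl (Or.inl h.symm)
  · exact Or.inl (Or.inr (Or.inr h))
  · exact Or.inl (Or.inr (Or.inl h))
  · exact Or.inr h.symm

theorem blk_rev {S : V → Prop} {A : List α} (h : T.Blk S A) : T.Blk S A.reverse := by
  refine ⟨⟨?_, ?_⟩, ?_⟩
  · simpa using h.1.2
  · simpa using h.1.1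
  · rw [List.isChain_reverse]
    exact h.2.imp fun _ _ => lk_symm

theorem blk_nil {S : V → Prop} : T.Blk S [] := ⟨⟨by simp, by simp⟩, by simp⟩

theorem lk_mono {S S' : V → Prop} (h : ∀ v, S v → S' v) {p q : α} (hh : T.lk S p q) : T.lk S' p q :=
  hh.imp id (fun h' => ⟨h _ h'.1, h _ h'.2⟩)

theorem blk_append {S : V → Prop} {A B : List α} (hA : T.Blk S A) (hB : T.Blk S B) : T.Blk S (A ++ B) := by
  refine ⟨⟨?_, ?_⟩, ?_⟩
  · cases A with
    | nil => exact hB.1.1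
    | cons a A => simpa using hA.1.1
  · intro x hx
    rw [List.getLast?_append] at hx
    cases hB' : B.getLast? with
    | none => rw [hB'] at hx; exact hA.1.2 x (by simpa using hx)
    | some b => rw [hB'] at hx; simp at hx; subst hx; exact hB.1.2 _ hB'
  · rw [List.isChain_append]
    refine ⟨hA.2, hB.2, fun x hx y hy => Or.inr ⟨hA.1.2 x hx, hB.1.1 y hy⟩⟩

/-- elements strictly before the last one -/
theorem mem_not_last {s : α → Prop} {A : List α} (hl : ∀ x ∈ A.getLast?, s x) {p : α} (hp : p ∈ A) (hs : ¬ s p) :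
    ∃ A' l, A = A' ++ [l] ∧ p ∈ A' ∧ s l := by
  have hA := List.ne_nil_of_mem hp
  obtain ⟨A', l, rfl⟩ : ∃ A'' i, A = A'' ++ [i] := ⟨A.dropLast, A.getLast hA, (List.dropLast_append_getLast hA).symm⟩
  have : s l := hl l (by simp)
  refine ⟨A', l, rfl, ?_, this⟩
  simp at hp
  rcases hp with hp | rfl
  · exact hp
  · exact absurd this hs

theorem cut {S S' : V → Prop} (hup : ∀ v, S v → S (T.par v)) (hSS : ∀ v, S v → S' v) {i : α} {A2 : List α}
    (hch : List.IsChain (T.lk S) (i :: A2)) (hlast : ∀ x ∈ (i :: A2).getLast?, S (T.vt x))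
    (hnx : NX T.Cross (i :: A2))
    (hS' : ∀ p ∈ i :: A2, S' (T.vt p) ↔ S (T.vt p) ∨ T.Anc (T.vt p) (T.vt i)) :
    ∃ P1 P2, i :: A2 = P1 ++ P2 ∧ T.Blk S' P1 ∧ T.Blk S' P2 ∧ (∀ p ∈ P2, S' (T.vt p) → S (T.vt p)) ∧
      (∀ p ∈ P1, ¬ S (T.vt p)) := by
  classical
  let D : α → Prop := fun p => ∃ t, ¬ S t ∧ T.Anc t (T.vt p) ∧ T.Anc t (T.vt i)
  have hD : ∀ p, D p → ¬ S (T.vt p) := fun p ⟨t, h1, h2, _⟩ h => h1 (up_anc hup h2 h)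
  obtain ⟨P1, P2, he, h1, h2⟩ : ∃ P1 P2, i :: A2 = P1 ++ P2 ∧ (∀ p ∈ P1, D p) ∧ (∀ p ∈ P2.head?, ¬ D p) := by
    refine ⟨(i :: A2).takeWhile (fun p => decide (D p)), (i :: A2).dropWhile (fun p => decide (D p)),
      List.takeWhile_append_dropWhile.symm, ?_, ?_⟩
    · intro p hp
      simpa using List.mem_takeWhile_imp hp
    · intro p hp
      have := List.head?_dropWhile_not (fun p => decide (D p)) (i :: A2)
      rw [Option.mem_def] at hp
      rw [hp] at this
      simpa using this
  have hcP : List.IsChain (T.lk S) (P1 ++ P2) := he ▸ hch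
  rw [List.isChain_append] at hcP
  obtain ⟨hc1, hc2, hc12⟩ := hcP
  -- last
  have hP2 : ∀ x ∈ P2.getLast?, S (T.vt x) := by
    intro x hx
    apply hlast
    rw [he, List.getLast?_append, Option.mem_def.1 hx]; rfl
  have hP2ne : P2 ≠ [] := by
    rintro rfl
    simp at he
    have hne : P1 ≠ [] := by rw [← he]; simp
    have := hlast (P1.getLast hne) (by rw [he]; exact List.getLast?_eq_getLast_of_ne_nil hne)
    exact hD _ (h1 _ (List.getLast_mem hne)) this
  -- no D in P2
  have hP2D : ∀ q ∈ P2, ¬ D q := by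
    intro q hq hDq
    obtain ⟨t, ht, htq, hti⟩ := hDq
    obtain ⟨y, P2', rfl⟩ := List.exists_cons_of_ne_nil hP2ne
    have hy : ¬ D y := h2 y (by simp)
    simp at hq
    rcases hq with rfl | hq
    · exact hy ⟨t, ht, htq, hti⟩
    have hq2 : ¬ S (T.vt q) := fun h => ht (up_anc hup htq h)
    obtain ⟨A', l, rfl, hqA, hl⟩ := mem_not_last (s := fun x => S (T.vt x)) (A := P2') (by
      intro x hx; apply hP2; rw [List.getLast?_cons, Option.mem_def.1 hx]; rfl) hq hq2
    cases P1 with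
    | nil =>
      simp at he
      obtain ⟨rfl, _⟩ := he
      exact hy ⟨t, ht, hti, hti⟩
    | cons i' P1 =>
      simp at he
      obtain ⟨rfl, rfl⟩ := he
      refine hnx.four (l1 := i :: P1) (l2 := [y]) (l3 := A') (l4 := [l]) (by simp) (by simp) (by simp) hqA (by simp)
        (Or.inr ⟨t, Or.inl ⟨hti, htq, fun h => hy ⟨t, ht, h, hti⟩, fun h => ht (up_anc hup h hl)⟩⟩)
  -- junction
  have hj : ∀ z ∈ P1.getLast?, ∀ y ∈ P2.head?, T.Anc (T.vt z) (T.vt i) ∧ T.vt y = T.par (T.vt z) := by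
    intro z hz y hy
    have hzD : D z := h1 z (List.mem_of_getLast? hz)
    have hyD : ¬ D y := h2 y hy
    obtain ⟨t, ht, htz, hti⟩ := hzD
    rcases hc12 z hz y hy with (h | h | h) | h
    · exact absurd ⟨t, ht, h ▸ htz, hti⟩ hyD
    · rcases anc_cases htz with rfl | h'
      · exact ⟨hti, h⟩
      · exact absurd ⟨t, ht, h ▸ h', hti⟩ hyD
    · exact absurd ⟨t, ht, anc_trans htz (h ▸ anc_par _), hti⟩ hyD
    · exact absurd h.1 (hD z ⟨t, ht, htz, hti⟩)
  obtain ⟨y, P2', hP2e⟩ := List.exists_cons_of_ne_nil hP2ne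
  have hmem1 : ∀ p ∈ P1, p ∈ i :: A2 := fun p hp => by rw [he]; simp [hp]
  have hmem2 : ∀ p ∈ P2, p ∈ i :: A2 := fun p hp => by rw [he]; simp [hp]
  have hSi : S' (T.vt i) := (hS' i (by simp)).2 (Or.inr (anc_refl _))
  refine ⟨P1, P2, he, ⟨⟨?_, ?_⟩, hc1.imp fun _ _ => lk_mono hSS⟩, ⟨⟨?_, ?_⟩, hc2.imp fun _ _ => lk_mono hSS⟩, ?_, ?_⟩
  · intro x hx
    cases P1 with
    | nil => simp at hx
    | cons a P1 =>
      simp at hx he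
      rw [← hx, ← he.1]; exact hSi
  · intro z hz
    exact (hS' z (hmem1 z (List.mem_of_getLast? hz))).2 (Or.inr (hj z hz y (by simp [hP2e])).1)
  · intro x hx
    cases hz : P1.getLast? with
    | none =>
      simp at hz
      subst hz
      simp at he
      rw [← he] at hx
      simp at hx
      rw [← hx]; exact hSi
    | some z =>
      obtain ⟨ha, hb⟩ := hj z hz x hx
      exact (hS' x (hmem2 x (List.mem_of_head? hx))).2 (Or.inr (anc_trans (hb ▸ anc_par _) ha))
  · intro x hx; exact hSS _ (hP2 x hx)
  · intro q hq hqS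
    rcases (hS' q (hmem2 q hq)).1 hqS with h | h
    · exact h
    · by_contra hc
      exact hP2D q hq ⟨T.vt q, hc, anc_refl _, h⟩
  · exact fun p hp => hD p (h1 p hp)

theorem cutL {S S' : V → Prop} (hup : ∀ v, S v → S (T.par v)) (hSS : ∀ v, S v → S' v) {A A1 t A2 : List α}
    (hA : A = A1 ++ t ++ A2) (ht : t.length ≤ 1) (ht2 : t = [] → A = [])
    (hB : T.Blk S A) (hnx : NX T.Cross A)
    (hS' : ∀ p ∈ A, S' (T.vt p) ↔ S (T.vt p) ∨ ∃ i ∈ t, T.Anc (T.vt p) (T.vt i)) :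
    ∃ P1 P2, t ++ A2 = P1 ++ P2 ∧ T.Blk S' P1 ∧ T.Blk S' P2 ∧ (∀ p ∈ P2, S' (T.vt p) → S (T.vt p)) ∧
      (∀ p ∈ P1, ¬ S (T.vt p)) := by
  rcases t with _ | ⟨i, _ | ⟨j, t⟩⟩
  · have := ht2 rfl
    rw [this] at hA
    simp at hA
    exact ⟨[], [], by simp [hA], blk_nil, blk_nil, by simp, by simp⟩
  · have e : A = A1 ++ i :: A2 := by simp [hA]
    refine cut hup hSS (A2 := A2) (i := i) ?_ ?_ ?_ ?_
    · have := hB.2; rw [e] at this; exact this.right_of_append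
    · intro x hx; apply hB.1.2; rw [e, List.getLast?_append, Option.mem_def.1 hx]; rfl
    · exact hnx.sub (by rw [e]; simp)
    · intro p hp
      rw [hS' p (by rw [e]; simp at hp ⊢; tauto)]
      simp
  · simp at ht

theorem cutR {S S' : V → Prop} (hup : ∀ v, S v → S (T.par v)) (hSS : ∀ v, S v → S' v) {A A1 t A2 : List α}
    (hA : A = A1 ++ t ++ A2) (ht : t.length ≤ 1) (ht2 : t = [] → A = [])
    (hB : T.Blk S A) (hnx : NX T.Cross A)
    (hS' : ∀ p ∈ A, S' (T.vt p) ↔ S (T.vt p) ∨ ∃ i ∈ t, T.Anc (T.vt p) (T.vt i)) :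
    ∃ Q1 Q2, A1 ++ t = Q1 ++ Q2 ∧ T.Blk S' Q1 ∧ T.Blk S' Q2 ∧ (∀ p ∈ Q1, S' (T.vt p) → S (T.vt p)) ∧
      (∀ p ∈ Q2, ¬ S (T.vt p)) := by
  have htr : t.reverse = t := by
    rcases t with _ | ⟨i, _ | ⟨j, t⟩⟩
    · rfl
    · rfl
    · simp at ht
  obtain ⟨P1, P2, he, h1, h2, h3, h4⟩ := cutL (A := A.reverse) (A1 := A2.reverse) (A2 := A1.reverse) hup hSS (t := t)
    (by rw [hA]; simp [htr]) ht (by simpa using ht2) (blk_rev hB) (nx_rev hnx) (by simpa using hS')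
  refine ⟨P2.reverse, P1.reverse, ?_, blk_rev h2, blk_rev h1, by simpa using h3, by simpa using h4⟩
  have := congrArg List.reverse he
  simpa [htr] using this

end Tour
end PPS

namespace PPS
open List Tour
variable {V α : Type} {T : Tour V α}

abbrev Asg {V W : Type} (lab : V → Option (W × Fin 3)) (v : V) : Prop := (lab v).isSome = true

def LabAdj {V α W E F : Type} (T : Tour V α) (X : TS W E F) (lab : V → Option (W × Fin 3)) (p q : α) : Prop :=
  ∃ x y, lab (T.vt p) = some x ∧ lab (T.vt q) = some y ∧ (x.1 = y.1 ∨ X.M.simple.Adj x.1 y.1)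

structure Inv {V α W E F : Type} (T : Tour V α) (X : TS W E F) (n : ℕ) (lab : V → Option (W × Fin 3))
    (reg : F → Fin 3 → List α) : Prop where
  up : ∀ v, Asg lab v → Asg lab (T.par v)
  inj : ∀ u v x, lab u = some x → lab v = some x → T.dep u = T.dep v → u = v
  nx : ∀ f, NX T.Cross (reg f 0 ++ (reg f 1 ++ reg f 2))
  blk : ∀ f m, T.Blk (Asg lab) (reg f m)
  labreg : ∀ f m p w k, p ∈ reg f m → lab (T.vt p) = some (w, k) → w = X.vt (f, m)
  uniq : ∀ t, ¬ Asg lab t → ∀ f g m m' p q, p ∈ reg f m → q ∈ reg g m' → T.Anc t (T.vt p) →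
    T.Anc t (T.vt q) → f = g
  cov : ∀ p ∈ T.L0, ¬ Asg lab (T.vt p) → ∃ f m, p ∈ reg f m
  chord : ∀ p ∈ T.L0, ∀ q ∈ T.L0, T.C p q → LabAdj T X lab p q ∨ ∃ f m m', p ∈ reg f m ∧ q ∈ reg f m'
  size : ∀ f, (reg f 0).length + (reg f 1).length + (reg f 2).length ≤ n

section
variable {W E F : Type} {X : TS W E F} {n : ℕ} {lab : V → Option (W × Fin 3)} {reg : F → Fin 3 → List α}

theorem fin3_cases : ∀ m m' : Fin 3, m' = m ∨ m' = m + 1 ∨ m = m' + 1 := by decide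

theorem ts_adj (X : TS W E F) (f : F) (m m' : Fin 3) :
    X.vt (f, m) = X.vt (f, m') ∨ X.M.simple.Adj (X.vt (f, m)) (X.vt (f, m')) := by
  by_cases h : X.vt (f, m) = X.vt (f, m')
  · exact Or.inl h
  · right
    have key : ∀ m, X.vt (f, m) ≠ X.vt (f, m+1) → X.M.simple.Adj (X.vt (f, m)) (X.vt (f, m + 1)) :=
      fun m h => ⟨h, X.ed (f, m), X.compat f m⟩
    have : m' = m ∨ m' = m + 1 ∨ m = m' + 1 := fin3_cases m m'
    rcases this with rfl | rfl | rfl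
    · exact absurd rfl h
    · exact key m h
    · exact (key m' (Ne.symm h)).symm

theorem Inv.labadj (I : Inv T X n lab reg) {f m m' p q} (hp : p ∈ reg f m) (hq : q ∈ reg f m')
    (hps : Asg lab (T.vt p)) (hqs : Asg lab (T.vt q)) : LabAdj T X lab p q := by
  obtain ⟨⟨w, k⟩, hx⟩ := Option.isSome_iff_exists.1 hps
  obtain ⟨⟨w', k'⟩, hy⟩ := Option.isSome_iff_exists.1 hqs
  refine ⟨_, _, hx, hy, ?_⟩
  simp only
  rw [I.labreg f m p w k hp hx, I.labreg f m' q w' k' hq hy]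
  exact ts_adj X f m m'

theorem Inv.clean (I : Inv T X n lab reg) : ∃ reg' : F → Fin 3 → List α, Inv T X n lab reg' ∧
    ∀ f, (∃ m, ∃ p ∈ reg' f m, ¬ Asg lab (T.vt p)) ∨ ∀ m, reg' f m = [] := by
  classical
  let act : F → Prop := fun f => ∃ m, ∃ p ∈ reg f m, ¬ Asg lab (T.vt p)
  let reg' : F → Fin 3 → List α := fun f m => if act f then reg f m else []
  have h1 : ∀ f m p, p ∈ reg' f m → act f ∧ p ∈ reg f m := by
    intro f m p hp
    by_cases h : act f
    · exact ⟨h, by simpa [reg', h] using hp⟩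
    · simp [reg', h] at hp
  have h2 : ∀ f, act f → reg' f = reg f := by
    intro f h; funext m; simp [reg', h]
  have h3 : ∀ f, ¬ act f → ∀ m, reg' f m = [] := by
    intro f h m; simp [reg', h]
  refine ⟨reg', ⟨I.up, I.inj, ?_, ?_, ?_, ?_, ?_, ?_, ?_⟩, ?_⟩
  · intro f
    by_cases h : act f
    · rw [h2 f h]; exact I.nx f
    · simp only [h3 f h]
      intro p q r s hs; simp at hs
  · intro f m
    by_cases h : act f
    · rw [h2 f h]; exact I.blk f m
    · rw [h3 f h]; exact blk_nil
  · intro f m p w k hp; exact I.labreg f m p w k (h1 _ _ _ hp).2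
  · intro t ht f g m m' p q hp hq; exact I.uniq t ht f g m m' p q (h1 _ _ _ hp).2 (h1 _ _ _ hq).2
  · intro p hp hps
    obtain ⟨f, m, h⟩ := I.cov p hp hps
    exact ⟨f, m, by rw [h2 f ⟨m, p, h, hps⟩]; exact h⟩
  · intro p hp q hq hC
    rcases I.chord p hp q hq hC with h | ⟨f, m, m', h, h'⟩
    · exact Or.inl h
    · by_cases ha : act f
      · right; exact ⟨f, m, m', by rw [h2 f ha]; exact ⟨h, h'⟩⟩
      · left
        refine I.labadj h h' ?_ ?_
        · by_contra hc; exact ha ⟨m, p, h, hc⟩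
        · by_contra hc; exact ha ⟨m', q, h', hc⟩
  · intro f
    by_cases h : act f
    · rw [h2 f h]; exact I.size f
    · simp [h3 f h]
  · intro f
    by_cases h : act f
    · left; rw [h2 f h]; exact h
    · exact Or.inr (h3 f h)

theorem Inv.nxm (I : Inv T X n lab reg) (f : F) (m : Fin 3) :
    NX T.Cross (reg f m ++ (reg f (m+1) ++ reg f (m+2))) := by
  have h0 := I.nx f
  have h1 := h0.rot cross_rot
  rw [List.append_assoc] at h1
  have h2 := h1.rot cross_rot
  rw [List.append_assoc] at h2
  fin_cases m
  · exact h0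
  · exact h1
  · exact h2

theorem Inv.sep (I : Inv T X n lab reg) {t : V} (ht : ¬ Asg lab t) {f g m m' p q}
    (hp : p ∈ reg f m) (hq : q ∈ reg g m') (hpt : T.Anc t (T.vt p)) (hqt : T.Anc t (T.vt q)) : f = g ∧ m = m' := by
  have hfg := I.uniq t ht f g m m' p q hp hq hpt hqt
  subst hfg
  refine ⟨rfl, ?_⟩
  have key : ∀ m p q, p ∈ reg f m → q ∈ reg f (m+1) → T.Anc t (T.vt p) → T.Anc t (T.vt q) → False := by
    intro m p q hp hq hpt hqt
    obtain ⟨A, l, hA, hpA, hl⟩ := mem_not_last (s := fun p => Asg lab (T.vt p)) (I.blk f m).1.2 hp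
      (fun h => ht (up_anc I.up hpt h))
    obtain ⟨B, l', hB, hqB, hl'⟩ := mem_not_last (s := fun p => Asg lab (T.vt p)) (I.blk f (m+1)).1.2 hq
      (fun h => ht (up_anc I.up hqt h))
    have := (I.nxm f m)
    rw [hA, hB] at this
    exact this.four (l1 := A) (l2 := [l]) (l3 := B) (l4 := [l'] ++ reg f (m+2)) (by simp) hpA (by simp) hqB (by simp)
      (Or.inr ⟨t, Or.inl ⟨hpt, hqt, fun h => ht (up_anc I.up h hl), fun h => ht (up_anc I.up h hl')⟩⟩)
  have : m' = m ∨ m' = m + 1 ∨ m = m' + 1 := fin3_cases m m'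
  rcases this with rfl | rfl | rfl
  · rfl
  · exact (key _ _ _ hp hq hpt hqt).elim
  · exact (key _ _ _ hq hp hqt hpt).elim

structure FP (R : α → α → Prop) (n : ℕ) (reg A1 t A2 : Fin 3 → List α) : Prop where
  len : ∀ m, (t m).length ≤ 1
  eq : ∀ m, reg m = A1 m ++ t m ++ A2 m
  emp : ∀ m, t m = [] → reg m = []
  arc : ∀ m, NoR R (A2 m ++ A1 (m+1)) (A2 (m+1) ++ A1 (m+2))
  tarc : ∀ m, NoR R (t m) (A2 (m+1) ++ A1 (m+2))
  size : ∀ m, (t m).length + (A2 m).length + (A1 (m+1)).length + (t (m+1)).length ≤ n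

theorem Inv.fp (I : Inv T X (n+1) lab reg) (f : F)
    (h : (∃ m, ∃ p ∈ reg f m, ¬ Asg lab (T.vt p)) ∨ ∀ m, reg f m = []) :
    ∃ A1 t A2, FP (fun p q => T.C p q ∧ ¬ (Asg lab (T.vt p) ∧ Asg lab (T.vt q))) n (reg f) A1 t A2 := by
  rcases h with ⟨m, u, hu, hus⟩ | h
  · have hR : ∀ p q, T.C p q ∧ ¬ (Asg lab (T.vt p) ∧ Asg lab (T.vt q)) →
      T.C q p ∧ ¬ (Asg lab (T.vt q) ∧ Asg lab (T.vt p)) := fun p q h => ⟨T.Csymm _ _ h.1, fun h' => h.2 h'.symm⟩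
    obtain ⟨A1, A2, ta, B1, B2, tb, C1, C2, tc, P⟩ := pick (R := fun p q => T.C p q ∧ ¬ (Asg lab (T.vt p) ∧ Asg lab (T.vt q)))
      hR (s := fun p => Asg lab (T.vt p))
      (fun x y hx hy h => h.2 ⟨hx, hy⟩) (I.blk f 0).1 (I.blk f 1).1 (I.blk f 2).1
      (by
        intro p q r s hs hx
        exact I.nx f p q r s hs (Or.inl ⟨hx.1.1, hx.2.1⟩)) hus (by
        fin_cases m
        · simp only [List.mem_append]; exact Or.inl hu
        · simp only [List.mem_append]; exact Or.inr (Or.inl hu)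
        · simp only [List.mem_append]; exact Or.inr (Or.inr hu))
    have hs := I.size f
    have p0 := P.p0
    have p1 := P.p1
    have p2 := P.p2
    refine ⟨![A1, B1, C1], ![ta, tb, tc], ![A2, B2, C2], ?_, ?_, ?_, ?_, ?_, ?_⟩
    · intro m; fin_cases m
      · exact P.la
      · exact P.lb
      · exact P.lc
    · intro m; fin_cases m
      · exact P.ea
      · exact P.eb
      · exact P.ec
    · intro m; fin_cases m
      · exact P.na
      · exact P.nb
      · exact P.nc
    · intro m; fin_cases m
      · exact P.x01
      · exact P.x12
      · exact P.x20
    · intro m; fin_cases m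
      · exact P.t0
      · exact P.t1
      · exact P.t2
    · intro m; fin_cases m
      · change ta.length + A2.length + B1.length + tb.length ≤ n; omega
      · change tb.length + B2.length + C1.length + tc.length ≤ n; omega
      · change tc.length + C2.length + A1.length + ta.length ≤ n; omega
  · refine ⟨fun _ => [], fun _ => [], fun _ => [], by simp, by simp [h], by simp [h], ?_, ?_, by simp⟩
    · intro m x hx; simp at hx
    · intro m x hx; simp at hx

end
end PPS

namespace PPS
open List Tour
variable {V α : Type} {T : Tour V α}
variable {W E F : Type} {X : TS W E F} {n : ℕ} {lab : V → Option (W × Fin 3)} {reg : F → Fin 3 → List α}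

theorem exists_lab (S : V → Prop) (N : F → Fin 3 → V → Prop)
    (hS : ∀ v, S v ↔ Asg lab v)
    (hN : ∀ v f k f' k', ¬ S v → N f k v → N f' k' v → f = f' ∧ k = k') :
    ∃ lab' : V → Option ((W ⊕ F) × Fin 3),
      (∀ v w k, lab v = some (w, k) → lab' v = some (Sum.inl w, k)) ∧
      (∀ v f k, ¬ Asg lab v → N f k v → lab' v = some (Sum.inr f, k)) ∧
      (∀ v x, lab' v = some x → (∃ w k, lab v = some (w, k) ∧ x = (Sum.inl w, k)) ∨
        (¬ Asg lab v ∧ ∃ f k, N f k v ∧ x = (Sum.inr f, k))) := by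
  classical
  let lab' : V → Option ((W ⊕ F) × Fin 3) := fun v => match lab v with
    | some (w, k) => some (Sum.inl w, k)
    | none => if h : ∃ fk : F × Fin 3, N fk.1 fk.2 v then some (Sum.inr h.choose.1, h.choose.2) else none
  refine ⟨lab', ?_, ?_, ?_⟩
  · intro v w k h; simp [lab', h]
  · intro v f k h hN'
    have h0 : lab v = none := by simpa using h
    have hex : ∃ fk : F × Fin 3, N fk.1 fk.2 v := ⟨(f, k), hN'⟩
    have := hN v _ _ _ _ (by rw [hS]; exact h) hex.choose_spec hN'
    simp only [lab', h0, dif_pos hex]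
    rw [this.1, this.2]
  · intro v x hx
    rcases h : lab v with _ | ⟨w, k⟩
    · right
      refine ⟨by simp [h], ?_⟩
      by_cases hex : ∃ fk : F × Fin 3, N fk.1 fk.2 v
      · simp only [lab', h, dif_pos hex] at hx
        exact ⟨_, _, hex.choose_spec, by simpa using hx.symm⟩
      · simp only [lab', h, dif_neg hex] at hx
        simp at hx
    · left
      simp [lab', h] at hx
      exact ⟨w, k, rfl, hx.symm⟩

set_option maxHeartbeats 2000000 in
theorem Inv.step (I : Inv T X (n+1) lab reg) : ∃ lab' reg', Inv T (cone X) n lab' reg' := by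
  obtain ⟨reg, I, hact⟩ := I.clean
  choose A1 t A2 P using fun f => I.fp f (hact f)
  let N : F → Fin 3 → V → Prop := fun f k v => ∃ i ∈ t f k, T.Anc v (T.vt i)
  have tmem : ∀ {f k i}, i ∈ t f k → i ∈ reg f k := by
    intro f k i hi; rw [(P f).eq k]; simp [hi]
  have a1mem : ∀ {f k i}, i ∈ A1 f k → i ∈ reg f k := by
    intro f k i hi; rw [(P f).eq k]; simp [hi]
  have a2mem : ∀ {f k i}, i ∈ A2 f k → i ∈ reg f k := by
    intro f k i hi; rw [(P f).eq k]; simp [hi]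
  obtain ⟨lab', L1, L2, L3⟩ := exists_lab (lab := lab) (Asg lab) N (fun _ => Iff.rfl) (by
    rintro v f k f' k' hv ⟨i, hi, hia⟩ ⟨i', hi', hia'⟩
    exact I.sep hv (tmem hi) (tmem hi') hia hia')
  have S1 : ∀ v, Asg lab v → Asg lab' v := by
    intro v hv
    obtain ⟨⟨w, k⟩, h⟩ := Option.isSome_iff_exists.1 hv
    exact Option.isSome_iff_exists.2 ⟨_, L1 v w k h⟩
  have S2 : ∀ v f k, N f k v → Asg lab' v := by
    intro v f k h
    by_cases hv : Asg lab v
    · exact S1 v hv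
    · exact Option.isSome_iff_exists.2 ⟨_, L2 v f k hv h⟩
  have S3 : ∀ v, Asg lab' v → Asg lab v ∨ ∃ f k, N f k v := by
    intro v hv
    obtain ⟨x, h⟩ := Option.isSome_iff_exists.1 hv
    rcases L3 v x h with ⟨w, k, h, -⟩ | ⟨-, f, k, h, -⟩
    · exact Or.inl (Option.isSome_iff_exists.2 ⟨_, h⟩)
    · exact Or.inr ⟨f, k, h⟩
  have up' : ∀ v, Asg lab' v → Asg lab' (T.par v) := by
    intro v hv
    rcases S3 v hv with h | ⟨f, k, i, hi, hia⟩
    · exact S1 _ (I.up v h)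
    · exact S2 _ f k ⟨i, hi, anc_trans (anc_par _) hia⟩
  have hS' : ∀ f m, ∀ p ∈ reg f m, Asg lab' (T.vt p) ↔ Asg lab (T.vt p) ∨ ∃ i ∈ t f m, T.Anc (T.vt p) (T.vt i) := by
    intro f m p hp
    constructor
    · intro h
      by_cases hv : Asg lab (T.vt p)
      · exact Or.inl hv
      · right
        rcases S3 _ h with h | ⟨g, k, i, hi, hia⟩
        · exact absurd h hv
        · obtain ⟨rfl, rfl⟩ := I.sep hv hp (tmem hi) (anc_refl _) hia
          exact ⟨i, hi, hia⟩
    · rintro (h | h)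
      · exact S1 _ h
      · exact S2 _ f m h
  have nxr : ∀ f m, NX T.Cross (reg f m) := fun f m => (I.nxm f m).sub (by simp)
  choose P1 P2 hP bP1 bP2 sP2 sP1 using fun f m => cutL I.up S1 ((P f).eq m) ((P f).len m) ((P f).emp m) (I.blk f m)
    (nxr f m) (hS' f m)
  choose Q1 Q2 hQ bQ1 bQ2 sQ1 sQ2 using fun f m => cutR I.up S1 ((P f).eq m) ((P f).len m) ((P f).emp m) (I.blk f m)
    (nxr f m) (hS' f m)
  have memP1 : ∀ {f m p}, p ∈ P1 f m → p ∈ t f m ∨ p ∈ A2 f m := by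
    intro f m p hp; rw [← List.mem_append, hP]; simp [hp]
  have memP2 : ∀ {f m p}, p ∈ P2 f m → p ∈ t f m ∨ p ∈ A2 f m := by
    intro f m p hp; rw [← List.mem_append, hP]; simp [hp]
  have memQ1 : ∀ {f m p}, p ∈ Q1 f m → p ∈ A1 f m ∨ p ∈ t f m := by
    intro f m p hp; rw [← List.mem_append, hQ]; simp [hp]
  have memQ2 : ∀ {f m p}, p ∈ Q2 f m → p ∈ A1 f m ∨ p ∈ t f m := by
    intro f m p hp; rw [← List.mem_append, hQ]; simp [hp]
  let reg' : F × Fin 3 → Fin 3 → List α := fun g =>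
    ![P2 g.1 g.2, Q1 g.1 (g.2+1), Q2 g.1 (g.2+1) ++ P1 g.1 g.2]
  have mreg' : ∀ f m p, (∃ j, p ∈ reg' (f, m) j) ↔ p ∈ t f m ∨ p ∈ A2 f m ∨ p ∈ A1 f (m+1) ∨ p ∈ t f (m+1) := by
    intro f m p
    constructor
    · rintro ⟨j, hj⟩
      fin_cases j
      · have := memP2 (f := f) (m := m) hj; tauto
      · have := memQ1 (f := f) (m := m+1) hj; tauto
      · have hj : p ∈ Q2 f (m+1) ++ P1 f m := hj
        rw [List.mem_append] at hj
        rcases hj with hj | hj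
        · have := memQ2 hj; tauto
        · have := memP1 hj; tauto
    · intro h
      have h' : p ∈ t f m ++ A2 f m ∨ p ∈ A1 f (m+1) ++ t f (m+1) := by
        simp only [List.mem_append]; tauto
      rw [hP, hQ, List.mem_append, List.mem_append] at h'
      rcases h' with (h | h) | (h | h)
      · exact ⟨2, List.mem_append_right _ h⟩
      · exact ⟨0, h⟩
      · exact ⟨1, h⟩
      · exact ⟨2, List.mem_append_left _ h⟩
  -- position classification
  have cls : ∀ f m p, p ∈ reg f m → p ∈ A1 f m ∨ p ∈ t f m ∨ p ∈ A2 f m := by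
    intro f m p hp
    rw [(P f).eq m] at hp
    simpa [or_assoc] using hp
  have f3 : ∀ m : Fin 3, m + 2 + 1 = m := by decide
  refine ⟨lab', reg', up', ?_, ?_, ?_, ?_, ?_, ?_, ?_, ?_⟩
  · -- inj
    intro u v x hu hv hd
    rcases L3 u x hu with ⟨w, k, h, rfl⟩ | ⟨-, f, k, ⟨i, hi, hia⟩, rfl⟩
    · rcases L3 v _ hv with ⟨w', k', h', he⟩ | ⟨-, f, k, -, he⟩
      · simp at he
        obtain ⟨rfl, rfl⟩ := he
        exact I.inj u v _ h h' hd
      · simp at he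
    · rcases L3 v _ hv with ⟨w', k', h', he⟩ | ⟨-, f', k', ⟨i', hi', hia'⟩, he⟩
      · simp at he
      · simp at he
        obtain ⟨rfl, rfl⟩ := he
        have hl := (P f).len k
        have : i = i' := by
          rcases ht : t f k with _ | ⟨a, _ | ⟨b, c⟩⟩
          · rw [ht] at hi; simp at hi
          · rw [ht] at hi hi'; simp at hi hi'; rw [hi, hi']
          · rw [ht] at hl; simp at hl
        subst this
        exact anc_eq hia hia' hd
  · -- nx
    rintro ⟨f, m⟩
    have h := (I.nxm f m).sub (l' := P1 f m ++ (P2 f m ++ (Q1 f (m+1) ++ Q2 f (m+1)))) (by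
      rw [(P f).eq m, (P f).eq (m+1), List.append_assoc (A1 f m), hP, hQ]
      simp only [List.append_assoc]
      refine (List.Sublist.append_left (List.Sublist.append_left ?_ _) _).trans (List.sublist_append_right _ _)
      refine List.Sublist.append_left ?_ _
      exact List.sublist_append_left _ _)
    have h := h.rot cross_rot
    change NX T.Cross (P2 f m ++ (Q1 f (m+1) ++ (Q2 f (m+1) ++ P1 f m)))
    simpa only [List.append_assoc] using h
  · -- blk
    rintro ⟨f, m⟩ j
    fin_cases j
    · exact bP2 f m
    · exact bQ1 f (m+1)
    · exact blk_append (bQ2 f (m+1)) (bP1 f m)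
  · -- labreg
    rintro ⟨f, m⟩ j p w k hp hl
    have old : ∀ {m'}, p ∈ reg f m' → Asg lab (T.vt p) → w = Sum.inl (X.vt (f, m')) := by
      intro m' hp hs
      obtain ⟨⟨w', k'⟩, h⟩ := Option.isSome_iff_exists.1 hs
      have := L1 _ _ _ h
      rw [hl] at this
      simp at this
      rw [this.1, I.labreg f m' p w' k' hp h]
    have new : ∀ {m'}, p ∈ reg f m' → ¬ Asg lab (T.vt p) → w = Sum.inr f := by
      intro m' hp hs
      rcases L3 _ _ hl with ⟨w', k', h, -⟩ | ⟨-, f', k', ⟨i, hi, hia⟩, he⟩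
      · exact absurd (Option.isSome_iff_exists.2 ⟨_, h⟩) hs
      · obtain ⟨rfl, rfl⟩ := I.sep hs hp (tmem hi) (anc_refl _) hia
        simp at he
        exact he.1
    have hs' : Asg lab' (T.vt p) := Option.isSome_iff_exists.2 ⟨_, hl⟩
    fin_cases j
    · have hp : p ∈ P2 f m := hp
      exact old (m' := m) ((memP2 hp).elim tmem a2mem) (sP2 f m p hp hs')
    · have hp : p ∈ Q1 f (m+1) := hp
      exact old (m' := m+1) ((memQ1 hp).elim a1mem tmem) (sQ1 f (m+1) p hp hs')
    · have hp : p ∈ Q2 f (m+1) ++ P1 f m := hp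
      rw [List.mem_append] at hp
      rcases hp with hp | hp
      · exact new ((memQ2 hp).elim a1mem tmem) (sQ2 f (m+1) p hp)
      · exact new ((memP1 hp).elim tmem a2mem) (sP1 f m p hp)
  · -- uniq
    rintro s hs ⟨f, m⟩ ⟨g, m'⟩ j j' p q hp hq hsp hsq
    have hs0 : ¬ Asg lab s := fun h => hs (S1 _ h)
    have nt : ∀ {x f k}, T.Anc s (T.vt x) → x ∉ t f k := fun {x f k} hx hxt => hs (S2 s f k ⟨x, hxt, hx⟩)
    have c1 : ∀ {p f m j}, p ∈ reg' (f, m) j → T.Anc s (T.vt p) → p ∈ A2 f m ∨ p ∈ A1 f (m+1) := by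
      intro p f m j hp hsp
      rcases (mreg' f m p).1 ⟨j, hp⟩ with h | h | h | h
      · exact absurd h (nt hsp)
      · exact Or.inl h
      · exact Or.inr h
      · exact absurd h (nt hsp)
    have bad : ∀ {p q f m}, p ∈ A2 f m → q ∈ A1 f m → T.Anc s (T.vt p) → T.Anc s (T.vt q) → False := by
      intro p q f m hp hq hsp hsq
      obtain ⟨i, hi⟩ : ∃ i, i ∈ t f m := by
        apply List.exists_mem_of_ne_nil
        intro h
        have := (P f).emp m h
        have h' := a2mem hp
        rw [this] at h'
        simp at h'
      obtain ⟨A', l, hA, hpA, hl⟩ := mem_not_last (s := fun p => Asg lab (T.vt p)) (A := A2 f m) (by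
        intro x hx
        apply (I.blk f m).1.2
        rw [(P f).eq m, List.getLast?_append, Option.mem_def.1 hx]; rfl) hp
        (fun h => hs0 (up_anc I.up hsp h))
      have hn := nxr f m
      rw [(P f).eq m, hA] at hn
      exact hn.four (l1 := A1 f m) (l2 := t f m) (l3 := A') (l4 := [l]) (by simp) hq hi hpA (by simp)
        (Or.inr ⟨s, Or.inl ⟨hsq, hsp, fun h => nt h hi, fun h => hs0 (up_anc I.up h hl)⟩⟩)
    rcases c1 hp hsp with h1 | h1 <;> rcases c1 hq hsq with h2 | h2
    · obtain ⟨rfl, rfl⟩ := I.sep hs0 (a2mem h1) (a2mem h2) hsp hsq; rfl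
    · obtain ⟨rfl, rfl⟩ := I.sep hs0 (a2mem h1) (a1mem h2) hsp hsq
      exact (bad h1 h2 hsp hsq).elim
    · obtain ⟨rfl, rfl⟩ := I.sep hs0 (a1mem h1) (a2mem h2) hsp hsq
      exact (bad h2 h1 hsq hsp).elim
    · obtain ⟨rfl, h⟩ := I.sep hs0 (a1mem h1) (a1mem h2) hsp hsq
      rw [add_right_cancel h]
  · -- cov
    intro p hp hps
    obtain ⟨f, m, h⟩ := I.cov p hp (fun h => hps (S1 _ h))
    rcases cls f m p h with h | h | h
    · obtain ⟨j, hj⟩ := (mreg' f (m+2) p).2 (by rw [f3]; tauto)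
      exact ⟨_, j, hj⟩
    · obtain ⟨j, hj⟩ := (mreg' f m p).2 (by tauto)
      exact ⟨_, j, hj⟩
    · obtain ⟨j, hj⟩ := (mreg' f m p).2 (by tauto)
      exact ⟨_, j, hj⟩
  · -- chord
    intro p hp q hq hC
    have up_adj : LabAdj T X lab p q → LabAdj T (cone X) lab' p q := by
      rintro ⟨x, y, hx, hy, h⟩
      refine ⟨(Sum.inl x.1, x.2), (Sum.inl y.1, y.2), L1 _ _ _ hx, L1 _ _ _ hy, ?_⟩
      rcases h with h | h
      · left; simp [h]
      · right; exact cone_adj_inl X h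
    rcases I.chord p hp q hq hC with h | ⟨f, m, m', hpm, hqm⟩
    · exact Or.inl (up_adj h)
    · by_cases hb : Asg lab (T.vt p) ∧ Asg lab (T.vt q)
      · exact Or.inl (up_adj (I.labadj hpm hqm hb.1 hb.2))
      · right
        suffices h : ∃ m, (p ∈ t f m ∨ p ∈ A2 f m ∨ p ∈ A1 f (m+1) ∨ p ∈ t f (m+1)) ∧
            (q ∈ t f m ∨ q ∈ A2 f m ∨ q ∈ A1 f (m+1) ∨ q ∈ t f (m+1)) by
          obtain ⟨m, h1, h2⟩ := h
          obtain ⟨j, hj⟩ := (mreg' f m p).2 h1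
          obtain ⟨j', hj'⟩ := (mreg' f m q).2 h2
          exact ⟨_, j, j', hj, hj'⟩
        have arcs : ∀ {f m p}, p ∈ reg f m → (∃ a, p ∈ A2 f a ++ A1 f (a+1)) ∨ ∃ a, p ∈ t f a := by
          intro f m p hp
          rcases cls f m p hp with h | h | h
          · left; exact ⟨m+2, by rw [f3]; simp [h]⟩
          · right; exact ⟨m, h⟩
          · left; exact ⟨m, by simp [h]⟩
        have hb' : ¬ (Asg lab (T.vt q) ∧ Asg lab (T.vt p)) := fun h => hb h.symm
        have hC' := T.Csymm _ _ hC
        have hta : ∀ p q a b, T.C p q → ¬ (Asg lab (T.vt p) ∧ Asg lab (T.vt q)) → p ∈ t f a → q ∈ A2 f b ++ A1 f (b+1) →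
            ∃ m, (p ∈ t f m ∨ p ∈ t f (m+1)) ∧ (q ∈ A2 f m ++ A1 f (m+1)) := by
          intro p q a b hC hb hp hq
          rcases fin3_cases a b with rfl | rfl | rfl
          · exact ⟨_, Or.inl hp, hq⟩
          · exact absurd ⟨hC, hb⟩ ((P f).tarc a p hp q (by simpa [add_assoc] using hq))
          · exact ⟨b, Or.inr hp, hq⟩
        rcases arcs hpm with ⟨a, ha⟩ | ⟨a, ha⟩ <;> rcases arcs hqm with ⟨b, hb2⟩ | ⟨b, hb2⟩
        · rcases fin3_cases a b with rfl | rfl | rfl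
          · simp only [List.mem_append] at ha hb2
            exact ⟨b, ha.elim (fun h => Or.inr (Or.inl h)) (fun h => Or.inr (Or.inr (Or.inl h))),
              hb2.elim (fun h => Or.inr (Or.inl h)) (fun h => Or.inr (Or.inr (Or.inl h)))⟩
          · exact absurd ⟨hC, hb⟩ ((P f).arc a p ha q (by simpa [add_assoc] using hb2))
          · exact absurd ⟨hC', hb'⟩ ((P f).arc b q hb2 p (by simpa [add_assoc] using ha))
        · obtain ⟨m, h1, h2⟩ := hta q p b a hC' hb' hb2 ha
          rw [List.mem_append] at h2
          exact ⟨m, h2.elim (fun h => Or.inr (Or.inl h)) (fun h => Or.inr (Or.inr (Or.inl h))),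
            h1.elim Or.inl (fun h => Or.inr (Or.inr (Or.inr h)))⟩
        · obtain ⟨m, h1, h2⟩ := hta p q a b hC hb ha hb2
          rw [List.mem_append] at h2
          exact ⟨m, h1.elim Or.inl (fun h => Or.inr (Or.inr (Or.inr h))),
            h2.elim (fun h => Or.inr (Or.inl h)) (fun h => Or.inr (Or.inr (Or.inl h)))⟩
        · rcases fin3_cases a b with rfl | rfl | rfl
          · exact ⟨b, Or.inl ha, Or.inl hb2⟩
          · exact ⟨a, Or.inl ha, Or.inr (Or.inr (Or.inr hb2))⟩
          · exact ⟨b, Or.inr (Or.inr (Or.inr ha)), Or.inl hb2⟩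
  · -- size
    rintro ⟨f, m⟩
    have h := (P f).size m
    have h1 := congrArg List.length (hP f m)
    have h2 := congrArg List.length (hQ f (m+1))
    change (P2 f m).length + (Q1 f (m+1)).length + (Q2 f (m+1) ++ P1 f m).length ≤ n
    simp only [List.length_append] at h1 h2 ⊢
    omega
end PPS

namespace PPS
open List Tour
variable {V α : Type}

def Concl (T : Tour V α) : Prop :=
  ∃ (W E F : Type) (_ : Finite W) (_ : Finite E) (_ : Finite F) (X : TS W E F) (lab : V → W × Fin 3),
    X.Good ∧ (∀ u v, lab u = lab v → T.dep u = T.dep v → u = v) ∧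
    ∀ p ∈ T.L0, ∀ q ∈ T.L0, T.C p q →
      (lab (T.vt p)).1 = (lab (T.vt q)).1 ∨ X.M.simple.Adj (lab (T.vt p)).1 (lab (T.vt q)).1

theorem concl_of_inv (T : Tour V α) (hT : T.Good) : ∀ (n : ℕ) (W E F : Type) [Finite W] [Finite E] [Finite F]
    (X : TS W E F) (_ : X.Good) (lab : V → Option (W × Fin 3)) (reg : F → Fin 3 → List α),
    Inv T X n lab reg → Concl T := by
  intro n
  induction n with
  | zero =>
    intro W E F _ _ _ X hX lab reg I
    have hr : ∀ f m, reg f m = [] := by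
      intro f m
      have := I.size f
      fin_cases m
      · exact List.length_eq_zero_iff.1 (by change (reg f 0).length = 0; omega)
      · exact List.length_eq_zero_iff.1 (by change (reg f 1).length = 0; omega)
      · exact List.length_eq_zero_iff.1 (by change (reg f 2).length = 0; omega)
    have ha : ∀ v, Asg lab v := by
      intro v
      by_contra hv
      obtain ⟨p, hp, rfl⟩ := hT.cov v
      obtain ⟨f, m, h⟩ := I.cov p hp hv
      rw [hr] at h
      simp at h
    choose lab' hl using fun v => Option.isSome_iff_exists.1 (ha v)
    refine ⟨W, E, F, inferInstance, inferInstance, inferInstance, X, lab', hX, ?_, ?_⟩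
    · intro u v h hd
      exact I.inj u v (lab' u) (hl u) (h ▸ hl v) hd
    · intro p hp q hq hC
      rcases I.chord p hp q hq hC with ⟨x, y, hx, hy, h⟩ | ⟨f, m, m', h, -⟩
      · rw [hl] at hx hy
        simp at hx hy
        rw [hx, hy]; exact h
      · rw [hr] at h
        simp at h
  | succ n ih =>
    intro W E F _ _ _ X hX lab reg I
    obtain ⟨lab', reg', I'⟩ := I.step
    exact ih _ _ _ (cone X) (cone_good X hX) lab' reg' I'

theorem tour_main (T : Tour V α) (hT : T.Good) : Concl T := by
  classical
  obtain ⟨p0, hp0, -⟩ := hT.cov T.r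
  have hne : T.L0 ≠ [] := List.ne_nil_of_mem hp0
  obtain ⟨a, ha⟩ : ∃ a, T.L0.head? = some a := ⟨_, List.head?_eq_some_head hne⟩
  obtain ⟨b, hb⟩ : ∃ b, T.L0.getLast? = some b := ⟨_, List.getLast?_eq_some_getLast hne⟩
  let lab : V → Option (Fin 3 × Fin 3) := fun v =>
    if T.Anc v (T.vt a) then some (0, 0) else if T.Anc v (T.vt b) then some (0, 1) else none
  let reg : Bool → Fin 3 → List α := fun f m => if f = true ∧ m = 0 then T.L0 else []
  have l1 : ∀ v x, lab v = some x → x.1 = 0 ∧ ((x.2 = 0 ∧ T.Anc v (T.vt a)) ∨ (x.2 = 1 ∧ T.Anc v (T.vt b))) := by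
    intro v x h
    by_cases h1 : T.Anc v (T.vt a)
    · simp [lab, h1] at h; subst h; simp [h1]
    · by_cases h2 : T.Anc v (T.vt b)
      · simp [lab, h1, h2] at h; subst h; simp [h2]
      · simp [lab, h1, h2] at h
  have s1 : ∀ v, Asg lab v ↔ T.Anc v (T.vt a) ∨ T.Anc v (T.vt b) := by
    intro v
    by_cases h1 : T.Anc v (T.vt a)
    · simp [Asg, lab, h1]
    · by_cases h2 : T.Anc v (T.vt b)
      · simp [Asg, lab, h1, h2]
      · simp [Asg, lab, h1, h2]
  have r1 : ∀ f m p, p ∈ reg f m → f = true ∧ m = 0 ∧ p ∈ T.L0 := by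
    intro f m p hp
    by_cases h : f = true ∧ m = 0
    · simp only [reg, if_pos h] at hp; exact ⟨h.1, h.2, hp⟩
    · simp only [reg, if_neg h] at hp; simp at hp
  have r2 : reg true 0 = T.L0 := by simp [reg]
  have blk : T.Blk (Asg lab) T.L0 := by
    refine ⟨⟨?_, ?_⟩, hT.chain.imp fun _ _ h => Or.inl h⟩
    · intro x hx
      rw [ha] at hx; simp at hx; subst hx
      exact (s1 _).2 (Or.inl (anc_refl _))
    · intro x hx
      rw [hb] at hx; simp at hx; subst hx
      exact (s1 _).2 (Or.inr (anc_refl _))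
  refine concl_of_inv T hT T.L0.length _ _ _ baseTS base_good lab reg ⟨?_, ?_, ?_, ?_, ?_, ?_, ?_, ?_, ?_⟩
  · intro v hv
    rw [s1] at hv ⊢
    exact hv.imp (anc_trans (anc_par _)) (anc_trans (anc_par _))
  · intro u v x hu hv hd
    obtain ⟨-, h1⟩ := l1 u x hu
    obtain ⟨-, h2⟩ := l1 v x hv
    rcases h1 with ⟨h1, h1'⟩ | ⟨h1, h1'⟩ <;> rcases h2 with ⟨h2, h2'⟩ | ⟨h2, h2'⟩
    · exact anc_eq h1' h2' hd
    · rw [h1] at h2; simp at h2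
    · rw [h1] at h2; simp at h2
    · exact anc_eq h1' h2' hd
  · intro f
    cases f
    · intro p q r s hs; simp [reg] at hs
    · simpa [reg] using hT.nx
  · intro f m
    by_cases h : f = true ∧ m = 0
    · simp only [reg, if_pos h]; exact blk
    · simp only [reg, if_neg h]; exact blk_nil
  · intro f m p w k hp hl
    obtain ⟨-, rfl, -⟩ := r1 f m p hp
    exact (l1 _ _ hl).1
  · intro t _ f g m m' p q hp hq _ _
    rw [(r1 f m p hp).1, (r1 g m' q hq).1]
  · intro p hp _
    exact ⟨true, 0, by rw [r2]; exact hp⟩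
  · intro p hp q hq _
    exact Or.inr ⟨true, 0, 0, by rw [r2]; exact ⟨hp, hq⟩⟩
  · intro f
    cases f <;> simp [reg]

end PPS

namespace PPS
open Multigraph

structure Bfs {V E : Type} (M : Multigraph V E) where
  r : V
  par : V → V
  dep : V → ℕ
  te : V → E
  par_r : par r = r
  dep_r : dep r = 0
  dep_par : ∀ v, v ≠ r → dep (par v) + 1 = dep v
  te_ends : ∀ v, v ≠ r → M.ends (te v) = s(v, par v)
  layer : ∀ u v, M.simple.Adj u v → dep u ≤ dep v + 1

variable {V E F : Type} {M : Multigraph V E}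

theorem exists_bfs (h : M.simple.Connected) (e0 : E) : Nonempty (Bfs M) := by
  classical
  obtain ⟨r⟩ := h.nonempty
  have key : ∀ v, ∃ (u : V) (e : E), (v = r → u = r) ∧ (v ≠ r → M.simple.dist u r + 1 = M.simple.dist v r ∧ M.ends e = s(v, u)) := by
    intro v
    by_cases hv : v = r
    · exact ⟨r, e0, fun _ => rfl, fun h => absurd hv h⟩
    · obtain ⟨p, hp⟩ := h.exists_walk_length_eq_dist v r
      cases p with
      | nil => exact absurd rfl hv
      | @cons _ u _ ha p =>
        obtain ⟨hne, e, he⟩ := ha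
        refine ⟨u, e, fun h => absurd h hv, fun _ => ⟨?_, he⟩⟩
        have h1 := SimpleGraph.dist_le p
        have h2 : M.simple.dist v r ≤ M.simple.dist v u + M.simple.dist u r := h.dist_triangle
        have h3 : M.simple.dist v u = 1 := SimpleGraph.dist_eq_one_iff_adj.2 ⟨hne, e, he⟩
        have hp' : p.length + 1 = M.simple.dist v r := hp
        omega
  choose par te h1 h2 using key
  refine ⟨⟨r, par, fun v => M.simple.dist v r, te, h1 r rfl, by simp, fun v hv => (h2 v hv).1, fun v hv => (h2 v hv).2, ?_⟩⟩
  intro u v ha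
  have h2 : M.simple.dist u r ≤ M.simple.dist u v + M.simple.dist v r := h.dist_triangle
  have h3 : M.simple.dist u v = 1 := SimpleGraph.dist_eq_one_iff_adj.2 ha
  omega

def AncP (par : V → V) (t v : V) : Prop := ∃ n, par^[n] v = t

namespace Bfs
variable (B : Bfs M)

def Tree (e : E) : Prop := ∃ v, v ≠ B.r ∧ B.te v = e

theorem te_inj {v w : V} (hv : v ≠ B.r) (hw : w ≠ B.r) (h : B.te v = B.te w) : v = w := by
  have h1 := B.te_ends v hv
  rw [h, B.te_ends w hw, Sym2.eq_iff] at h1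
  rcases h1 with h1 | ⟨h1, h2⟩
  · exact h1.1.symm
  · have a := B.dep_par v hv
    have b := B.dep_par w hw
    rw [h2] at b
    rw [← h1] at a
    omega

theorem dep_iter_le (n : ℕ) (v : V) : B.dep (B.par^[n] v) ≤ B.dep v := by
  induction n generalizing v with
  | zero => exact le_rfl
  | succ n ih =>
    rw [Function.iterate_succ_apply]
    refine (ih _).trans ?_
    by_cases hv : v = B.r
    · subst hv; rw [B.par_r]
    · have := B.dep_par v hv; omega

theorem not_anc_par {t : V} (ht : t ≠ B.r) : ¬ AncP B.par t (B.par t) := by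
  rintro ⟨n, hn⟩
  have := B.dep_iter_le n (B.par t)
  rw [hn] at this
  have := B.dep_par t ht
  omega

theorem anc_iff {t v : V} (h : v ≠ t) : AncP B.par t v ↔ AncP B.par t (B.par v) := by
  constructor
  · rintro ⟨n, hn⟩
    cases n with
    | zero => exact absurd hn h
    | succ n => exact ⟨n, hn⟩
  · rintro ⟨n, hn⟩
    exact ⟨n + 1, hn⟩

end Bfs

theorem occ_pair (emb : M.Embedding F) (e : E) : ∃ p p' : F × ℕ, p ≠ p' ∧
    ∀ q, IsOcc emb.boundary e q ↔ q = p ∨ q = p' := by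
  obtain ⟨p, p', hne, h⟩ := Set.ncard_eq_two.1 (emb.edge_twice e)
  refine ⟨p, p', hne, fun q => ?_⟩
  have : q ∈ {p : F × ℕ | IsOcc emb.boundary e p} ↔ q ∈ ({p, p'} : Set (F × ℕ)) := by rw [h]
  simpa using this

open Classical in
theorem closure_tree [Finite F] [Finite E] (emb : M.Embedding F) (B : Bfs M) (K : F → Prop)
    (hK : ∀ e, ¬ B.Tree e → ∀ p p', IsOcc emb.boundary e p → IsOcc emb.boundary e p' → K p.1 → K p'.1)
    (t : V) (ht : t ≠ B.r) (p p' : F × ℕ) (hp : IsOcc emb.boundary (B.te t) p)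
    (hp' : IsOcc emb.boundary (B.te t) p') (hKp : K p.1) : K p'.1 := by
  have := Fintype.ofFinite F
  have := Fintype.ofFinite E
  by_contra hKp'
  let χ : V → ZMod 2 := fun v => if AncP B.par t v then 1 else 0
  let δ : E → ZMod 2 := fun e => Sym2.lift ⟨fun u v => χ u + χ v, fun u v => add_comm _ _⟩ (M.ends e)
  have hδ : ∀ e u v, M.ends e = s(u, v) → δ e = χ u + χ v := by
    intro e u v h; simp [δ, h]
  let O : Finset (Σ _ : F, ℕ) := (Finset.univ.filter K).sigma (fun f => Finset.range (emb.boundary f).len)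
  let ed : (Σ _ : F, ℕ) → E := fun q => (emb.boundary q.1).edge q.2
  have hO : ∀ q : Σ _ : F, ℕ, q ∈ O ↔ K q.1 ∧ q.2 < (emb.boundary q.1).len := by
    intro q; simp [O]
  have hsum : ∑ q ∈ O, δ (ed q) = 0 := by
    rw [Finset.sum_sigma]
    refine Finset.sum_eq_zero fun f _ => ?_
    have h1 : ∀ i, δ (ed ⟨f, i⟩) = χ ((emb.boundary f).vtx (i+1)) - χ ((emb.boundary f).vtx i) := by
      intro i
      rw [hδ _ _ _ ((emb.boundary f).compat i), CharTwo.sub_eq_add, add_comm]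
    simp only [h1]
    rw [Finset.sum_range_sub (fun i => χ ((emb.boundary f).vtx i))]
    have := (emb.boundary f).vtx_per 0
    rw [zero_add] at this
    rw [this, sub_self]
  have hfib : ∑ q ∈ O, δ (ed q) = ∑ e : E, ∑ q ∈ O with ed q = e, δ (ed q) :=
    (Finset.sum_fiberwise O ed (fun q => δ (ed q))).symm
  have hpp : p ≠ p' := by rintro rfl; exact hKp' hKp
  have hocc : ∀ q, IsOcc emb.boundary (B.te t) q → q = p ∨ q = p' := by
    obtain ⟨a, b, hab, h⟩ := occ_pair emb (B.te t)
    intro q hq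
    rw [h] at hq hp hp'
    rcases hp with rfl | rfl <;> rcases hp' with rfl | rfl
    · exact absurd rfl hpp
    · exact hq
    · exact hq.symm
    · exact absurd rfl hpp
  have hval : ∀ e, ∑ q ∈ O with ed q = e, δ (ed q) = if e = B.te t then 1 else 0 := by
    intro e
    have h0 : ∑ q ∈ O with ed q = e, δ (ed q) = ∑ q ∈ O with ed q = e, δ e :=
      Finset.sum_congr rfl (fun q hq => by rw [(Finset.mem_filter.1 hq).2])
    rw [h0]
    by_cases he : e = B.te t
    · rw [if_pos he]
      subst he
      have : Finset.filter (fun q => ed q = B.te t) O = {⟨p.1, p.2⟩} := by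
        ext q
        rw [Finset.mem_filter, hO, Finset.mem_singleton]
        constructor
        · rintro ⟨⟨h1, h2⟩, h3⟩
          rcases hocc (q.1, q.2) ⟨h2, h3⟩ with h | h
          · rw [← h]
          · exfalso; apply hKp'; rw [← h]; exact h1
        · rintro rfl
          exact ⟨⟨hKp, hp.1⟩, hp.2⟩
      rw [this, Finset.sum_singleton, hδ _ _ _ (B.te_ends t ht)]
      have h1 : AncP B.par t t := ⟨0, rfl⟩
      have h2 := B.not_anc_par ht
      simp [χ, h1, h2]
    · rw [if_neg he]
      by_cases htr : B.Tree e
      · obtain ⟨v, hv, rfl⟩ := htr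
        have hvt : v ≠ t := by rintro rfl; exact he rfl
        have : δ (B.te v) = 0 := by
          rw [hδ _ _ _ (B.te_ends v hv)]
          have h1 := B.anc_iff hvt
          simp only [χ, h1]
          exact CharTwo.add_self_eq_zero _
        simp [this]
      · obtain ⟨a, b, hab, h⟩ := occ_pair emb e
        have ha := (h a).2 (Or.inl rfl)
        have hb := (h b).2 (Or.inr rfl)
        by_cases hKa : K a.1
        · have hKb := hK e htr a b ha hb hKa
          have : Finset.filter (fun q => ed q = e) O = {⟨a.1, a.2⟩, ⟨b.1, b.2⟩} := by
            ext q
            rw [Finset.mem_filter, hO, Finset.mem_insert, Finset.mem_singleton]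
            constructor
            · rintro ⟨⟨h1, h2⟩, h3⟩
              rcases (h (q.1, q.2)).1 ⟨h2, h3⟩ with h | h
              · left; rw [← h]
              · right; rw [← h]
            · rintro (rfl | rfl)
              · exact ⟨⟨hKa, ha.1⟩, ha.2⟩
              · exact ⟨⟨hKb, hb.1⟩, hb.2⟩
          rw [this, Finset.sum_pair]
          · exact CharTwo.add_self_eq_zero _
          · intro hh
            apply hab
            have h1 := congrArg Sigma.fst hh
            have h2 := congrArg Sigma.snd hh
            exact Prod.ext h1 h2
        · have hKb : ¬ K b.1 := fun hh => hKa (hK e htr b a hb ha hh)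
          have : Finset.filter (fun q => ed q = e) O = ∅ := by
            ext q
            rw [Finset.mem_filter, hO]
            constructor
            · rintro ⟨⟨h1, h2⟩, h3⟩
              rcases (h (q.1, q.2)).1 ⟨h2, h3⟩ with h | h
              · exfalso; apply hKa; rw [← h]; exact h1
              · exfalso; apply hKb; rw [← h]; exact h1
            · intro hq; simp at hq
          rw [this]; simp
  rw [hfib] at hsum
  simp only [hval] at hsum
  simp at hsum

theorem edge_corners (emb : M.Embedding F) {e : E} {u v : V} (h : M.ends e = s(u, v)) :
    ∃ f i, i < (emb.boundary f).len ∧ (emb.boundary f).edge i = e ∧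
      s((emb.boundary f).vtx i, (emb.boundary f).vtx ((i+1) % (emb.boundary f).len)) = s(u, v) := by
  obtain ⟨p, p', -, hp⟩ := occ_pair emb e
  obtain ⟨h1, h2⟩ := (hp p).2 (Or.inl rfl)
  refine ⟨p.1, p.2, h1, h2, ?_⟩
  have := (emb.boundary p.1).compat p.2
  rw [h2, h] at this
  have hv : (emb.boundary p.1).vtx ((p.2+1) % (emb.boundary p.1).len) = (emb.boundary p.1).vtx (p.2+1) := by
   by_cases hl : p.2 + 1 < (emb.boundary p.1).len
   · rw [Nat.mod_eq_of_lt hl]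
   · have : p.2 + 1 = (emb.boundary p.1).len := by omega
     rw [this, Nat.mod_self]
     have := (emb.boundary p.1).vtx_per 0
     rw [zero_add] at this
     exact this.symm
  rw [hv, this]

theorem closure [Finite F] [Finite E] (emb : M.Embedding F) (B : Bfs M) (K : F → Prop)
    (hK : ∀ e, ¬ B.Tree e → ∀ p p', IsOcc emb.boundary e p → IsOcc emb.boundary e p' → K p.1 → K p'.1)
    (f0 : F) (hf0 : K f0) (f : F) : K f := by
  have hall : ∀ e p p', IsOcc emb.boundary e p → IsOcc emb.boundary e p' → K p.1 → K p'.1 := by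
    intro e p p' hp hp' hk
    by_cases htr : B.Tree e
    · obtain ⟨t, ht, rfl⟩ := htr
      exact closure_tree emb B K hK t ht p p' hp hp' hk
    · exact hK e htr p p' hp hp' hk
  have hcor : ∀ v c c', Relation.EqvGen (CornerLinked emb.boundary v) c c' → (K c.1 ↔ K c'.1) := by
    intro v c c' h
    induction h with
    | rel x y h =>
      obtain ⟨-, -, e, p, p', -, h1, h2, h3, h4⟩ := h
      rw [h3.1, h4.1]
      exact ⟨hall e p p' h1 h2, hall e p' p h2 h1⟩
    | refl => rfl
    | symm _ _ _ ih => exact ih.symm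
    | trans _ _ _ _ _ ih1 ih2 => exact ih1.trans ih2
  have hv : ∀ v c c', IsCorner emb.boundary v c → IsCorner emb.boundary v c' → K c.1 → K c'.1 :=
    fun v c c' h h' => (hcor v c c' (emb.link_conn v c c' h h')).1
  have hadj : ∀ u v, M.simple.Adj u v → (∃ c, IsCorner emb.boundary u c ∧ K c.1) → (∃ c, IsCorner emb.boundary v c ∧ K c.1) := by
    rintro u v ⟨-, e, he⟩ ⟨c, hc, hk⟩
    obtain ⟨g, i, hi, -, hs⟩ := edge_corners emb he
    have hi' : (i+1) % (emb.boundary g).len < (emb.boundary g).len := Nat.mod_lt _ (by omega)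
    rw [Sym2.eq_iff] at hs
    rcases hs with ⟨h1, h2⟩ | ⟨h1, h2⟩
    · exact ⟨(g, (i+1) % (emb.boundary g).len), ⟨hi', h2⟩, hv u c (g, i) hc ⟨hi, h1⟩ hk⟩
    · exact ⟨(g, i), ⟨hi, h1⟩, hv u c (g, (i+1) % (emb.boundary g).len) hc ⟨hi', h2⟩ hk⟩
  have hwalk : ∀ u v (p : M.simple.Walk u v), (∃ c, IsCorner emb.boundary u c ∧ K c.1) →
      (∃ c, IsCorner emb.boundary v c ∧ K c.1) := by
    intro u v p
    induction p with
    | nil => exact id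
    | cons h _ ih => exact fun hh => ih (hadj _ _ h hh)
  obtain ⟨p⟩ := emb.conn.preconnected ((emb.boundary f0).vtx 0) ((emb.boundary f).vtx 0)
  obtain ⟨c, hc, hk⟩ := hwalk _ _ p ⟨(f0, 0), ⟨(emb.boundary f0).len_pos, rfl⟩, hf0⟩
  exact hv _ c (f, 0) hc ⟨(emb.boundary f).len_pos, rfl⟩ hk

/-- count of cotree edges -/
theorem card_cotree [Finite V] [Finite E] (B : Bfs M) :
    Nat.card {e // ¬ B.Tree e} + Nat.card V = Nat.card E + 1 := by
  classical
  have := Fintype.ofFinite V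
  have := Fintype.ofFinite E
  have e1 : Nat.card {e // B.Tree e} = Nat.card {v // v ≠ B.r} := by
    refine (Nat.card_congr (Equiv.ofBijective (fun v : {v // v ≠ B.r} => (⟨B.te v.1, v.1, v.2, rfl⟩ : {e // B.Tree e})) ⟨?_, ?_⟩)).symm
    · rintro ⟨v, hv⟩ ⟨w, hw⟩ h
      exact Subtype.ext (B.te_inj hv hw (congrArg Subtype.val h))
    · rintro ⟨e, v, hv, rfl⟩
      exact ⟨⟨v, hv⟩, rfl⟩
  have e2 : Nat.card {v // v ≠ B.r} + 1 = Nat.card V := by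
    have hpos : 0 < Fintype.card V := Fintype.card_pos_iff.2 ⟨B.r⟩
    simp
    omega
  have e3 : Nat.card {e // B.Tree e} + Nat.card {e // ¬ B.Tree e} = Nat.card E := by
    rw [← Nat.card_sum]
    exact Nat.card_congr (Equiv.sumCompl _)
  omega
end PPS

namespace PPS
open Multigraph

inductive Item (V F : Type) where
  | cor (c : F × ℕ) : Item V F
  | side (p : F × ℕ) (u w : V) : Item V F

variable {V E F : Type} {M : Multigraph V E}

namespace Item
def swap : Item V F → Item V F
  | cor c => cor c
  | side p u w => side p w u

def sid : Item V F → Option (F × ℕ)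
  | cor _ => none
  | side p _ _ => some p

def face : Item V F → F
  | cor c => c.1
  | side p _ _ => p.1

def src (emb : M.Embedding F) : Item V F → V
  | cor c => (emb.boundary c.1).vtx c.2
  | side _ u _ => u

def dst (emb : M.Embedding F) : Item V F → V
  | cor c => (emb.boundary c.1).vtx c.2
  | side _ _ w => w

theorem swap_swap (x : Item V F) : x.swap.swap = x := by cases x <;> rfl
theorem sid_swap (x : Item V F) : x.swap.sid = x.sid := by cases x <;> rfl
theorem face_swap (x : Item V F) : x.swap.face = x.face := by cases x <;> rfl
theorem src_swap (emb : M.Embedding F) (x : Item V F) : x.swap.src emb = x.dst emb := by cases x <;> rfl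
theorem dst_swap (emb : M.Embedding F) (x : Item V F) : x.swap.dst emb = x.src emb := by cases x <;> rfl
end Item
open Item

def Wk (emb : M.Embedding F) : V → List (Item V F) → V → Prop
  | u, [], w => u = w
  | u, x :: l, w => x.src emb = u ∧ Wk emb (x.dst emb) l w

theorem Wk.append {emb : M.Embedding F} : ∀ {u : V} {l l' : List (Item V F)} {w : V},
    Wk emb u (l ++ l') w ↔ ∃ v, Wk emb u l v ∧ Wk emb v l' w
  | u, [], l', w => by simp [Wk]
  | u, x :: l, l', w => by simp [Wk, Wk.append, and_assoc]

theorem Wk.rev {emb : M.Embedding F} {u : V} {l : List (Item V F)} {w : V} (h : Wk emb u l w) :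
    Wk emb w (l.reverse.map swap) u := by
  induction l generalizing u with
  | nil => exact h.symm
  | cons x l ih =>
    simp only [List.reverse_cons, List.map_append, List.map_cons, List.map_nil]
    refine Wk.append.2 ⟨_, ih h.2, ?_⟩
    exact ⟨src_swap emb x, (dst_swap emb x).trans h.1⟩

theorem Wk.chain {emb : M.Embedding F} {u : V} {l : List (Item V F)} {w : V} (h : Wk emb u l w) :
    l.IsChain (fun x y => x.dst emb = y.src emb) := by
  induction l generalizing u with
  | nil => exact List.isChain_nil
  | cons x l ih =>
    cases l with
    | nil => exact List.isChain_singleton _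
    | cons y l =>
      rw [List.isChain_cons_cons]
      exact ⟨h.2.1.symm, ih h.2⟩

def CC (emb : M.Embedding F) (x y : Item V F) : Prop :=
  ∃ f i, i < (emb.boundary f).len ∧ ((x = cor (f, i) ∧ y = cor (f, (i+1) % (emb.boundary f).len)) ∨
    (y = cor (f, i) ∧ x = cor (f, (i+1) % (emb.boundary f).len)))

theorem CC.symm {emb : M.Embedding F} {x y : Item V F} (h : CC emb x y) : CC emb y x := by
  obtain ⟨f, i, hi, h⟩ := h
  exact ⟨f, i, hi, h.symm⟩

theorem CC.face {emb : M.Embedding F} {x y : Item V F} (h : CC emb x y) : x.face = y.face := by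
  obtain ⟨f, i, hi, ⟨rfl, rfl⟩ | ⟨rfl, rfl⟩⟩ := h <;> rfl

theorem CC.swap {emb : M.Embedding F} {x y : Item V F} (h : CC emb x.swap y.swap) : CC emb x y := by
  obtain ⟨f, i, hi, ⟨hx, hy⟩ | ⟨hy, hx⟩⟩ := h <;>
  · cases x <;> simp [Item.swap] at hx
    cases y <;> simp [Item.swap] at hy
    subst hx hy
    exact ⟨f, i, hi, by simp⟩

structure St (emb : M.Embedding F) (B : Bfs M) (K : Finset F) (D : Finset E) (L : List (Item V F)) : Prop where
  wk : ∃ u, Wk emb u L u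
  sv : ∀ p u w, side p u w ∈ L → IsOcc emb.boundary ((emb.boundary p.1).edge p.2) p ∧
    M.ends ((emb.boundary p.1).edge p.2) = s(u, w) ∧ (emb.boundary p.1).edge p.2 ∉ D
  nd : (L.filterMap sid).Nodup
  fk : ∀ x ∈ L, x.face ∈ K
  cn : ∀ f ∈ K, ∀ i < (emb.boundary f).len, cor (f, i) ∈ L
  oc : ∀ e p, IsOcc emb.boundary e p → p.1 ∈ K → e ∉ D → ∃ u w, side p u w ∈ L
  dt : ∀ e ∈ D, ¬ B.Tree e
  cd : D.card + 1 = K.card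
  dk : ∀ e ∈ D, ∀ p, IsOcc emb.boundary e p → p.1 ∈ K
  nx : NX (RX (CC emb)) L

theorem mem_rs {L : List (Item V F)} {x : Item V F} : x ∈ L.reverse.map swap ↔ x.swap ∈ L := by
  simp only [List.mem_map, List.mem_reverse]
  constructor
  · rintro ⟨y, hy, rfl⟩; rw [swap_swap]; exact hy
  · intro h; exact ⟨_, h, swap_swap x⟩

theorem St.rev {emb : M.Embedding F} {B : Bfs M} {K : Finset F} {D : Finset E} {L : List (Item V F)}
    (h : St emb B K D L) : St emb B K D (L.reverse.map swap) where
  wk := by obtain ⟨u, hu⟩ := h.wk; exact ⟨u, hu.rev⟩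
  sv := by
    intro p u w hp
    rw [mem_rs] at hp
    have := h.sv p w u hp
    rw [Sym2.eq_swap]; exact this
  nd := by
    rw [List.filterMap_map]
    have : (sid ∘ swap : Item V F → _) = sid := funext sid_swap
    rw [this, List.filterMap_reverse, List.nodup_reverse]
    exact h.nd
  fk := by
    intro x hx
    rw [mem_rs] at hx
    rw [← face_swap]; exact h.fk _ hx
  cn := by
    intro f hf i hi
    rw [mem_rs]; exact h.cn f hf i hi
  oc := by
    intro e p h1 h2 h3
    obtain ⟨u, w, hh⟩ := h.oc e p h1 h2 h3
    exact ⟨w, u, mem_rs.2 hh⟩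
  dt := h.dt
  cd := h.cd
  dk := h.dk
  nx := by
    intro p q r s hs hx
    rw [List.sublist_map_iff] at hs
    obtain ⟨l', hl, he⟩ := hs
    have hl2 := hl.reverse
    rw [List.reverse_reverse] at hl2
    have he2 : l' = [p.swap, q.swap, r.swap, s.swap] := by
      have := congrArg (List.map swap) he
      rw [List.map_map] at this
      have h2 : (swap ∘ swap : Item V F → _) = id := funext swap_swap
      rw [h2, List.map_id] at this
      rw [← this]; rfl
    subst he2
    refine h.nx _ _ _ _ hl2 ⟨?_, ?_⟩
    · apply CC.swap; rw [swap_swap, swap_swap]; exact hx.2.symm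
    · apply CC.swap; rw [swap_swap, swap_swap]; exact hx.1.symm

theorem NX_glue {emb : M.Embedding F} {K : Finset F} {g : F} (hg : g ∉ K) {L G : List (Item V F)}
    (hL : NX (RX (CC emb)) L) (hG : NX (RX (CC emb)) G) (fL : ∀ x ∈ L, x.face ∈ K) (fG : ∀ x ∈ G, x.face = g) :
    NX (RX (CC emb)) (L ++ G) := by
  intro p q r s hs hx
  have key : ∀ x ∈ L, ∀ y ∈ G, CC emb x y → False := by
    intro x hx y hy hc
    apply hg
    rw [← fG y hy, ← hc.face]; exact fL x hx
  rw [List.sublist_append_iff] at hs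
  obtain ⟨m1, m2, he, h1, h2⟩ := hs
  have s1 := h1.subset
  have s2 := h2.subset
  rcases m1 with _ | ⟨a, _ | ⟨b, _ | ⟨c, _ | ⟨d, _ | ⟨e, m⟩⟩⟩⟩⟩ <;> simp at he
  · subst he; exact hG _ _ _ _ h2 hx
  · obtain ⟨rfl, rfl⟩ := he; exact key p (s1 (by simp)) r (s2 (by simp)) hx.1
  · obtain ⟨rfl, rfl, rfl⟩ := he; exact key p (s1 (by simp)) r (s2 (by simp)) hx.1
  · obtain ⟨rfl, rfl, rfl, rfl⟩ := he; exact key q (s1 (by simp)) s (s2 (by simp)) hx.2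
  · obtain ⟨rfl, rfl, rfl, rfl, rfl⟩ := he; exact hL _ _ _ _ h1 hx

theorem St.cut {emb : M.Embedding F} {B : Bfs M} {K : Finset F} {D : Finset E} {L : List (Item V F)}
    (h : St emb B K D L) {p : F × ℕ} {u w : V} (hp : side p u w ∈ L) :
    ∃ L', L.Perm (side p u w :: L') ∧ Wk emb w L' u ∧ NX (RX (CC emb)) L' := by
  obtain ⟨P, Q, rfl⟩ := List.append_of_mem hp
  refine ⟨Q ++ P, ?_, ?_, ?_⟩
  · exact List.perm_middle.trans (List.Perm.cons _ List.perm_append_comm)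
  · obtain ⟨v, hv⟩ := h.wk
    rw [Wk.append] at hv
    obtain ⟨x, h1, h2, h3⟩ := hv
    refine Wk.append.2 ⟨v, h3, ?_⟩
    have : u = x := h2
    rw [this]; exact h1
  · apply NX.rot (RX_rot fun _ _ => CC.symm)
    apply h.nx.sub
    simp

theorem St.step [DecidableEq F] [DecidableEq E] {emb : M.Embedding F} {B : Bfs M} {K : Finset F} {D : Finset E} {L G : List (Item V F)}
    {g : F} (hg : g ∉ K) (h : St emb B K D L) (hG : St emb B {g} ∅ G) {e : E} (he : ¬ B.Tree e) {p p' : F × ℕ}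
    (hp : IsOcc emb.boundary e p) (hp' : IsOcc emb.boundary e p') (hpK : p.1 ∈ K) (hpg : p'.1 = g) :
    ∃ L', St emb B (insert g K) (insert e D) L' := by
  have heD : e ∉ D := fun hh => hg (hpg ▸ h.dk e hh p' hp')
  obtain ⟨u, w, hpL⟩ := h.oc e p hp hpK heD
  obtain ⟨a, b, hpG⟩ := hG.oc e p' hp' (by simp [hpg]) (by simp)
  obtain ⟨G, a, b, hG, hpG, rfl, rfl⟩ : ∃ G a b, St emb B {g} ∅ G ∧ side p' a b ∈ G ∧ a = w ∧ b = u := by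
    have h1 := (h.sv _ _ _ hpL).2.1
    have h2 := (hG.sv _ _ _ hpG).2.1
    rw [hp.2] at h1
    rw [hp'.2, h1, Sym2.eq_iff] at h2
    rcases h2 with ⟨rfl, rfl⟩ | ⟨rfl, rfl⟩
    · exact ⟨_, w, u, hG.rev, mem_rs.2 hpG, rfl, rfl⟩
    · exact ⟨G, w, u, hG, hpG, rfl, rfl⟩
  obtain ⟨L1, pL, wL, nL⟩ := h.cut hpL
  obtain ⟨G1, pG, wG, nG⟩ := hG.cut hpG
  have hocc : ∀ q, IsOcc emb.boundary e q → q = p ∨ q = p' := by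
    have hpp : p ≠ p' := by rintro rfl; exact hg (hpg ▸ hpK)
    obtain ⟨x, y, hab, h⟩ := occ_pair emb e
    intro q hq
    rw [h] at hq hp hp'
    grind
  have mL : ∀ x, x ∈ L ↔ x = side p b a ∨ x ∈ L1 := fun x => by rw [pL.mem_iff, List.mem_cons]
  have mG : ∀ x, x ∈ G ↔ x = side p' a b ∨ x ∈ G1 := fun x => by rw [pG.mem_iff, List.mem_cons]
  have ndL : (p :: L1.filterMap sid).Nodup := (pL.filterMap sid).nodup_iff.1 h.nd
  have ndG : (p' :: G1.filterMap sid).Nodup := (pG.filterMap sid).nodup_iff.1 hG.nd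
  rw [List.nodup_cons] at ndL ndG
  have fL : ∀ x ∈ L1, x.face ∈ K := fun x hx => h.fk x ((mL x).2 (Or.inr hx))
  have fG : ∀ x ∈ G1, x.face = g := fun x hx => by simpa using hG.fk x ((mG x).2 (Or.inr hx))
  have sf : ∀ (q : F × ℕ) (x : Item V F), x.sid = some q → x.face = q.1 := by
    intro q x hx
    cases x <;> simp [sid] at hx
    subst hx; rfl
  have noL : ∀ q u w, side q u w ∈ L1 → (emb.boundary q.1).edge q.2 ≠ e := by
    intro q u w hq hh
    have h1 := (h.sv q u w ((mL _).2 (Or.inr hq))).1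
    rw [hh] at h1
    rcases hocc q h1 with rfl | rfl
    · exact ndL.1 (List.mem_filterMap.2 ⟨_, hq, rfl⟩)
    · exact hg (hpg ▸ fL _ hq)
  have noG : ∀ q u w, side q u w ∈ G1 → (emb.boundary q.1).edge q.2 ≠ e := by
    intro q u w hq hh
    have h1 := (hG.sv q u w ((mG _).2 (Or.inr hq))).1
    rw [hh] at h1
    rcases hocc q h1 with rfl | rfl
    · exact hg (fG _ hq ▸ hpK)
    · exact ndG.1 (List.mem_filterMap.2 ⟨_, hq, rfl⟩)
  refine ⟨L1 ++ G1, ?_, ?_, ?_, ?_, ?_, ?_, ?_, ?_, ?_, ?_⟩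
  · exact ⟨a, Wk.append.2 ⟨b, wL, wG⟩⟩
  · intro q u w hq
    rw [List.mem_append] at hq
    rcases hq with hq | hq
    · have := h.sv q u w ((mL _).2 (Or.inr hq))
      refine ⟨this.1, this.2.1, ?_⟩
      rw [Finset.mem_insert]
      rintro (hh | hh)
      · exact noL q u w hq hh
      · exact this.2.2 hh
    · have := hG.sv q u w ((mG _).2 (Or.inr hq))
      refine ⟨this.1, this.2.1, ?_⟩
      rw [Finset.mem_insert]
      rintro (hh | hh)
      · exact noG q u w hq hh
      · have h3 := h.dk _ hh q this.1
        have h4 : q.1 = g := fG _ hq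
        exact hg (h4 ▸ h3)
  · rw [List.filterMap_append]
    refine List.Nodup.append ndL.2 ndG.2 ?_
    intro q h1 h2
    rw [List.mem_filterMap] at h1 h2
    obtain ⟨x, hx, hx'⟩ := h1
    obtain ⟨y, hy, hy'⟩ := h2
    have := fL x hx
    rw [sf q x hx', ← sf q y hy', fG y hy] at this
    exact hg this
  · intro x hx
    rw [List.mem_append] at hx
    rw [Finset.mem_insert]
    rcases hx with hx | hx
    · exact Or.inr (fL x hx)
    · exact Or.inl (fG x hx)
  · intro f hf i hi
    rw [Finset.mem_insert] at hf
    rw [List.mem_append]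
    rcases hf with rfl | hf
    · have := hG.cn f (by simp) i hi
      rw [mG] at this
      right; simpa using this
    · have := h.cn f hf i hi
      rw [mL] at this
      left; simpa using this
  · intro e' q hq hqK he'
    rw [Finset.mem_insert, not_or] at he'
    rw [Finset.mem_insert] at hqK
    rcases hqK with hqK | hqK
    · obtain ⟨x, y, hh⟩ := hG.oc e' q hq (by simp [hqK]) (by simp)
      refine ⟨x, y, List.mem_append.2 (Or.inr ?_)⟩
      rw [mG] at hh
      rcases hh with hh | hh
      · simp at hh
        rw [hh.1] at hq
        exact absurd (hq.2.symm.trans hp'.2) he'.1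
      · exact hh
    · obtain ⟨x, y, hh⟩ := h.oc e' q hq hqK he'.2
      refine ⟨x, y, List.mem_append.2 (Or.inl ?_)⟩
      rw [mL] at hh
      rcases hh with hh | hh
      · simp at hh
        rw [hh.1] at hq
        exact absurd (hq.2.symm.trans hp.2) he'.1
      · exact hh
  · intro e' h'
    rw [Finset.mem_insert] at h'
    rcases h' with rfl | h'
    · exact he
    · exact h.dt e' h'
  · rw [Finset.card_insert_of_notMem heD, Finset.card_insert_of_notMem hg, h.cd]
  · intro e' h' q hq
    rw [Finset.mem_insert] at h' ⊢
    rcases h' with rfl | h'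
    · rcases hocc q hq with rfl | rfl
      · exact Or.inr hpK
      · exact Or.inl hpg
    · exact Or.inr (h.dk e' h' q hq)
  · exact NX_glue hg nL nG fL fG

def faceList (emb : M.Embedding F) (g : F) (n : ℕ) : List (Item V F) :=
  (List.range n).flatMap fun i => [cor (g, i), side (g, i) ((emb.boundary g).vtx i) ((emb.boundary g).vtx (i+1))]

theorem mem_faceList {emb : M.Embedding F} {g : F} {n : ℕ} {x : Item V F} : x ∈ faceList emb g n ↔
    ∃ i < n, x = cor (g, i) ∨ x = side (g, i) ((emb.boundary g).vtx i) ((emb.boundary g).vtx (i+1)) := by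
  simp [faceList]

theorem faceList_succ (emb : M.Embedding F) (g : F) (n : ℕ) : faceList emb g (n+1) = faceList emb g n ++
    [cor (g, n), side (g, n) ((emb.boundary g).vtx n) ((emb.boundary g).vtx (n+1))] := by
  simp [faceList, List.range_succ]

def posi : Item V F → Option ℕ
  | cor c => some c.2
  | side _ _ _ => none

theorem face_pw (emb : M.Embedding F) (g : F) (n : ℕ) : (faceList emb g n).Pairwise
    (fun x y => ∀ i j, x = cor (g, i) → y = cor (g, j) → i < j) := by
  induction n with
  | zero => simp [faceList]
  | succ n ih =>
    rw [faceList_succ, List.pairwise_append]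
    refine ⟨ih, by simp, ?_⟩
    intro x hx y hy i j hxi hyj
    subst hxi hyj
    obtain ⟨k, hk, h⟩ := mem_faceList.1 hx
    simp at h hy
    omega

theorem face_st (emb : M.Embedding F) (B : Bfs M) (g : F) :
    St emb B {g} ∅ (faceList emb g (emb.boundary g).len) where
  wk := by
    have : ∀ n, Wk emb ((emb.boundary g).vtx 0) (faceList emb g n) ((emb.boundary g).vtx n) := by
      intro n
      induction n with
      | zero => simp [faceList, Wk]
      | succ n ih =>
        rw [faceList_succ, Wk.append]
        exact ⟨_, ih, rfl, rfl, rfl⟩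
    refine ⟨(emb.boundary g).vtx 0, ?_⟩
    have h1 := this (emb.boundary g).len
    have h2 := (emb.boundary g).vtx_per 0
    rw [zero_add] at h2
    rw [h2] at h1
    exact h1
  sv := by
    intro p u w h
    obtain ⟨i, hi, h⟩ := mem_faceList.1 h
    simp at h
    obtain ⟨rfl, rfl, rfl⟩ := h
    exact ⟨⟨hi, rfl⟩, (emb.boundary g).compat i, by simp⟩
  nd := by
    have : ∀ n, (faceList emb g n).filterMap sid = (List.range n).map (fun i => (g, i)) := by
      intro n
      induction n with
      | zero => simp [faceList]
      | succ n ih => rw [faceList_succ, List.filterMap_append, ih, List.range_succ, List.map_append]; rfl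
    rw [this]
    exact List.nodup_range.map (fun i j h => (Prod.ext_iff.1 h).2)
  fk := by
    intro x hx
    obtain ⟨i, hi, rfl | rfl⟩ := mem_faceList.1 hx <;> simp [face]
  cn := by
    intro f hf i hi
    rw [Finset.mem_singleton] at hf; subst hf
    exact mem_faceList.2 ⟨i, hi, Or.inl rfl⟩
  oc := by
    rintro e ⟨f, i⟩ ⟨h1, h2⟩ h3 -
    have h3 : f = g := by simpa using h3
    subst h3
    exact ⟨_, _, mem_faceList.2 ⟨i, h1, Or.inr rfl⟩⟩
  dt := by simp
  cd := by simp
  dk := by simp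
  nx := by
    intro p q r s hs hx
    have hpw := (face_pw emb g _).sublist hs
    simp at hpw
    have key : ∀ x y, x ∈ faceList emb g (emb.boundary g).len → CC emb x y → ∃ i j, x = cor (g, i) ∧ y = cor (g, j) ∧
        i < (emb.boundary g).len ∧ j < (emb.boundary g).len ∧
        (j = (i + 1) % (emb.boundary g).len ∨ i = (j+1) % (emb.boundary g).len) := by
      rintro x y hx ⟨f, i, hi, h⟩
      obtain ⟨k, hk, hx⟩ := mem_faceList.1 hx
      have hm : (i+1) % (emb.boundary f).len < (emb.boundary f).len := Nat.mod_lt _ (by omega)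
      rcases h with ⟨rfl, rfl⟩ | ⟨rfl, rfl⟩
      · simp at hx
        obtain ⟨rfl, rfl⟩ := hx
        exact ⟨i, _, rfl, rfl, hi, hm, Or.inl rfl⟩
      · simp at hx
        obtain ⟨rfl, hx⟩ := hx
        exact ⟨_, i, rfl, rfl, hm, hi, Or.inr rfl⟩
    obtain ⟨i, k, rfl, rfl, hi, hk, h1⟩ := key p r (hs.subset (by simp)) hx.1
    obtain ⟨j, l, rfl, rfl, hj, hl, h2⟩ := key q s (hs.subset (by simp)) hx.2
    simp at hpw
    have aux : ∀ a n, a < n → (a + 1) % n = a + 1 ∨ ((a+1) % n = 0 ∧ a + 1 = n) := by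
      intro a n h
      by_cases h' : a + 1 < n
      · left; exact Nat.mod_eq_of_lt h'
      · right
        have : a + 1 = n := by omega
        rw [this]; simp
    have a1 := aux i _ hi
    have a2 := aux k _ hk
    omega

open Classical in
theorem exists_st [Finite F] [Finite E] (emb : M.Embedding F) (B : Bfs M) (f0 : F) :
    ∃ K D L, St emb B K D L ∧ ∀ f, f ∈ K := by
  have := Fintype.ofFinite F
  have key : ∀ n K D L, (Finset.univ \ K).card ≤ n → f0 ∈ K → St emb B K D L → ∃ K D L, St emb B K D L ∧ ∀ f, f ∈ K := by
    intro n
    induction n with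
    | zero =>
      intro K D L hn _ h
      refine ⟨K, D, L, h, fun f => ?_⟩
      have : Finset.univ \ K = ∅ := by simpa using hn
      by_contra hf
      have h2 : f ∈ Finset.univ \ K := by simp [hf]
      rw [this] at h2; simp at h2
    | succ n ih =>
      intro K D L hn hf0 h
      by_cases hall : ∀ f, f ∈ K
      · exact ⟨K, D, L, h, hall⟩
      · have hex : ∃ e, ¬ B.Tree e ∧ ∃ p p', IsOcc emb.boundary e p ∧ IsOcc emb.boundary e p' ∧ p.1 ∈ K ∧ p'.1 ∉ K := by
          by_contra hcon
          apply hall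
          intro f
          refine closure emb B (· ∈ K) ?_ f0 hf0 f
          intro e he p p' h1 h2 h3
          by_contra h4
          exact hcon ⟨e, he, p, p', h1, h2, h3, h4⟩
        obtain ⟨e, he, p, p', h1, h2, h3, h4⟩ := hex
        obtain ⟨L', h'⟩ := h.step h4 (face_st emb B p'.1) he h1 h2 h3 rfl
        refine ih _ _ _ ?_ (Finset.mem_insert_of_mem hf0) h'
        have : Finset.univ \ insert p'.1 K ⊂ Finset.univ \ K := by
          rw [Finset.ssubset_iff]
          refine ⟨p'.1, by simp, ?_⟩
          intro x hx
          simp at hx ⊢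
          rcases hx with rfl | hx
          · exact h4
          · tauto
        have := Finset.card_lt_card this
        omega
  exact key _ {f0} ∅ _ le_rfl (by simp) (face_st emb B f0)

end PPS

namespace PPS
open Multigraph
open Item
variable {V E F : Type} {M : Multigraph V E}

theorem alt_aux {emb : M.Embedding F} (I : V → Prop) (bad : Item V F → Bool) :
    ∀ (L m : List (Item V F)) (u w : V), Wk emb u L w → (∀ x ∈ L, bad x = false → (I (x.src emb) ↔ I (x.dst emb))) →
      List.Sublist m L → List.IsChain (fun x y => ¬ (I x ↔ I y)) (u :: m.map (src emb)) → m.length ≤ L.countP bad := by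
  intro L
  induction L with
  | nil =>
    intro m u w _ _ hm _
    rw [List.sublist_nil] at hm
    subst hm; simp
  | cons x L ih =>
    intro m u w hw hb hm hc
    have hb' : ∀ x ∈ L, bad x = false → (I (x.src emb) ↔ I (x.dst emb)) := fun y hy => hb y (by simp [hy])
    obtain ⟨rfl, hw⟩ := hw
    cases hm with
    | @cons _ _ _ hm =>
      rw [List.countP_cons]
      cases m with
      | nil => simp
      | cons y m =>
        rw [List.map_cons, List.isChain_cons_cons] at hc
        by_cases hd : I (x.dst emb) ↔ I (y.src emb)
        · have hbx : bad x = true := by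
            by_contra hbx
            have := hb x (by simp) (by simpa using hbx)
            exact hc.1 (this.trans hd)
          have h1 : List.IsChain (fun x y => ¬ (I x ↔ I y)) (x.dst emb :: m.map (src emb)) := by
            cases m with
            | nil => exact List.isChain_singleton _
            | cons z m =>
              have h2 := hc.2
              rw [List.map_cons, List.isChain_cons_cons] at h2 ⊢
              exact ⟨fun h => h2.1 (hd.symm.trans h), h2.2⟩
          have := ih m _ w hw hb' ((List.sublist_cons_self _ _).trans hm) h1
          simp [hbx]; exact this
        · have := ih (y :: m) _ w hw hb' hm (by
            rw [List.map_cons, List.isChain_cons_cons]; exact ⟨hd, hc.2⟩)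
          omega
    | @cons_cons m _ _ hm =>
      rw [List.map_cons, List.isChain_cons_cons] at hc
      exact absurd Iff.rfl hc.1

open Classical in
theorem count_bad {emb : M.Embedding F} {B : Bfs M} {K : Finset F} {D : Finset E} {L : List (Item V F)}
    (h : St emb B K D L) (e : E) :
    L.countP (fun x => decide (∃ p u w, x = side p u w ∧ (emb.boundary p.1).edge p.2 = e)) ≤ 2 := by
  have h1 : L.countP (fun x => decide (∃ p u w, x = side p u w ∧ (emb.boundary p.1).edge p.2 = e)) =
      (L.filterMap sid).countP (fun p => decide ((emb.boundary p.1).edge p.2 = e)) := by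
    clear h
    induction L with
    | nil => simp
    | cons x L ih =>
      cases x with
      | cor c =>
        rw [List.countP_cons, ih]
        simp [sid]
        rfl
      | side p u w =>
        have e1 : (side p u w :: L).filterMap sid = p :: L.filterMap sid := rfl
        have e2 : (∃ p' u' w', (side p u w : Item V F) = side p' u' w' ∧ (emb.boundary p'.1).edge p'.2 = e) ↔
            (emb.boundary p.1).edge p.2 = e := by
          constructor
          · rintro ⟨p', u', w', h, h'⟩
            injection h with h; subst h; exact h'
          · intro h; exact ⟨p, u, w, rfl, h⟩
        rw [e1, List.countP_cons, List.countP_cons, ih]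
        simp only [e2]
  rw [h1, List.countP_eq_length_filter]
  have hnd := h.nd.filter (fun p => decide ((emb.boundary p.1).edge p.2 = e))
  obtain ⟨p, p', -, ho⟩ := occ_pair emb e
  have hsub : (L.filterMap sid).filter (fun p => decide ((emb.boundary p.1).edge p.2 = e)) ⊆ [p, p'] := by
    intro q hq
    rw [List.mem_filter, List.mem_filterMap] at hq
    obtain ⟨⟨x, hx, hxq⟩, he⟩ := hq
    have he : (emb.boundary q.1).edge q.2 = e := by simpa using he
    cases x <;> simp [sid] at hxq
    subst hxq
    have := (h.sv _ _ _ hx).1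
    rw [he] at this
    simpa using (ho _).1 this
  simpa using (hnd.subperm hsub).length_le

theorem tour_of_emb [Finite V] [Finite E] [Finite F] (emb : M.Embedding F) (hg : emb.eulerGenus ≤ 0) :
    ∃ (dep : V → ℕ) (W E' F' : Type) (_ : Finite W) (_ : Finite E') (_ : Finite F') (X : TS W E' F') (lab : V → W × Fin 3),
    X.Good ∧ (∀ u v, lab u = lab v → dep u = dep v → u = v) ∧
    (∀ u v, M.simple.Adj u v → dep u ≤ dep v + 1) ∧
    ∀ u v, M.simple.Adj u v → (lab u).1 = (lab v).1 ∨ X.M.simple.Adj (lab u).1 (lab v).1 := by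
  classical
  have hg' : Nat.card E + 2 ≤ Nat.card V + Nat.card F := by
    unfold Embedding.eulerGenus at hg; omega
  have hF : Nonempty F := by
    by_contra hF
    rw [not_nonempty_iff] at hF
    have hE : IsEmpty E := by
      refine ⟨fun e => ?_⟩
      obtain ⟨p, -⟩ := occ_pair emb e
      exact hF.elim p.1
    have h1 : Nat.card F = 0 := Nat.card_of_isEmpty
    have h2 : Nat.card E = 0 := Nat.card_of_isEmpty
    have h3 : 1 < Nat.card V := by omega
    rw [Finite.one_lt_card_iff_nontrivial] at h3
    obtain ⟨u, v, huv⟩ := h3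
    obtain ⟨p⟩ := emb.conn.preconnected u v
    cases p with
    | nil => exact huv rfl
    | cons h _ => obtain ⟨-, e, -⟩ := h; exact hE.elim e
  obtain ⟨f0⟩ := hF
  obtain ⟨B⟩ := exists_bfs emb.conn ((emb.boundary f0).edge 0)
  obtain ⟨K, D, L, hS, hK⟩ := exists_st emb B f0
  have := Fintype.ofFinite E
  have := Fintype.ofFinite F
  have hcor : ∀ f i, i < (emb.boundary f).len → cor (f, i) ∈ L := fun f i hi => hS.cn f (hK f) i hi
  have hD : ∀ e, ¬ B.Tree e → e ∈ D := by
    have h1 := card_cotree B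
    have h2 : K.card = Nat.card F := by
      rw [Nat.card_eq_fintype_card, ← Finset.card_univ]
      congr 1; ext f; simp [hK]
    have h3 := hS.cd
    have h4 : Nat.card {e // ¬ B.Tree e} = (Finset.univ.filter (fun e => ¬ B.Tree e)).card := by
      rw [Nat.card_eq_fintype_card, Fintype.card_subtype]
    have h5 : D = Finset.univ.filter (fun e => ¬ B.Tree e) := by
      apply Finset.eq_of_subset_of_card_le
      · intro e he; simpa using hS.dt e he
      · omega
    intro e he
    rw [h5]; simpa using he
  have hside : ∀ p u w, side p u w ∈ L → ∃ v, v ≠ B.r ∧ B.te v = (emb.boundary p.1).edge p.2 ∧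
      ((u = v ∧ w = B.par v) ∨ (u = B.par v ∧ w = v)) := by
    intro p u w h
    obtain ⟨-, h1, h2⟩ := hS.sv p u w h
    have h3 : B.Tree ((emb.boundary p.1).edge p.2) := by
      by_contra h3; exact h2 (hD _ h3)
    obtain ⟨v, hv, hve⟩ := h3
    refine ⟨v, hv, hve, ?_⟩
    have h4 := B.te_ends v hv
    rw [hve, h1, Sym2.eq_iff] at h4
    exact h4
  obtain ⟨u0, hwk⟩ := hS.wk
  let T : Tour V (Item V F) := ⟨B.par, B.dep, B.r, src emb, CC emb, L, B.par_r, B.dep_r, B.dep_par, fun _ _ => CC.symm⟩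
  have halt : ∀ t p q r s, List.Sublist [p, q, r, s] L →
      ¬ (AncP B.par t (src emb p) ↔ AncP B.par t (src emb q)) →
      ¬ (AncP B.par t (src emb q) ↔ AncP B.par t (src emb r)) →
      ¬ (AncP B.par t (src emb r) ↔ AncP B.par t (src emb s)) → False := by
    intro t p q r s hs h1 h2 h3
    have hc := count_bad hS (B.te t)
    have hb : ∀ x ∈ L, decide (∃ p u w, x = side p u w ∧ (emb.boundary p.1).edge p.2 = B.te t) = false →
        (AncP B.par t (x.src emb) ↔ AncP B.par t (x.dst emb)) := by
      intro x hx hbx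
      rw [decide_eq_false_iff_not] at hbx
      cases x with
      | cor c => rfl
      | side p u w =>
        obtain ⟨v, hv, hve, h⟩ := hside p u w hx
        have hvt : v ≠ t := by
          rintro rfl; exact hbx ⟨p, u, w, rfl, hve.symm⟩
        rcases h with ⟨rfl, rfl⟩ | ⟨rfl, rfl⟩
        · exact B.anc_iff hvt
        · exact (B.anc_iff hvt).symm
    by_cases h0 : AncP B.par t u0 ↔ AncP B.par t (src emb p)
    · have := alt_aux (AncP B.par t) _ L [q, r, s] u0 u0 hwk hb ((List.sublist_cons_self _ _).trans hs) (by
        simp only [List.map_cons, List.map_nil, List.isChain_cons_cons, List.isChain_singleton, and_true]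
        exact ⟨fun h => h1 (h0.symm.trans h), h2, h3⟩)
      simp only [List.length_cons, List.length_nil] at this; omega
    · have := alt_aux (AncP B.par t) _ L [p, q, r, s] u0 u0 hwk hb hs (by
        simp only [List.map_cons, List.map_nil, List.isChain_cons_cons, List.isChain_singleton, and_true]
        exact ⟨h0, h1, h2, h3⟩)
      simp only [List.length_cons, List.length_nil] at this; omega
  have hT : T.Good := by
    refine ⟨?_, ?_, ?_⟩
    · rintro p q r s hs (h | ⟨t, ⟨h1, h2, h3, h4⟩ | ⟨h1, h2, h3, h4⟩⟩)
      · exact hS.nx p q r s hs h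
      · exact halt t p q r s hs (fun h => h3 (h.1 h1)) (fun h => h3 (h.2 h2)) (fun h => h4 (h.1 h2))
      · exact halt t p q r s hs (fun h => h1 (h.2 h3)) (fun h => h2 (h.1 h3)) (fun h => h2 (h.2 h4))
    · have hch := hwk.chain
      refine List.IsChain.imp_of_mem_imp ?_ hch
      intro x y hx hy hxy
      cases x with
      | cor c => exact Or.inl hxy
      | side p u w =>
        have hxy : w = y.src emb := hxy
        obtain ⟨v, hv, hve, ⟨h1, h2⟩ | ⟨h1, h2⟩⟩ := hside p u w hx
        · right; left
          show y.src emb = B.par u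
          rw [← hxy, h2, h1]
        · right; right
          show u = B.par (y.src emb)
          rw [← hxy, h2, h1]
    · intro v
      show ∃ p ∈ L, src emb p = v
      obtain ⟨p⟩ := emb.conn.preconnected v ((emb.boundary f0).vtx 0)
      generalize hz : (emb.boundary f0).vtx 0 = z at p
      cases p with
      | nil => exact ⟨_, hcor f0 0 (emb.boundary f0).len_pos, hz⟩
      | cons h _ =>
        obtain ⟨-, e, he⟩ := h
        obtain ⟨g, i, hi, -, hs⟩ := edge_corners emb he
        have hi' : (i+1) % (emb.boundary g).len < (emb.boundary g).len := Nat.mod_lt _ (by omega)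
        rw [Sym2.eq_iff] at hs
        rcases hs with ⟨h1, h2⟩ | ⟨h1, h2⟩
        · exact ⟨_, hcor g i hi, h1⟩
        · exact ⟨_, hcor g _ hi', h2⟩
  obtain ⟨W, E', F', i1, i2, i3, X, lab, hX, h1, h2⟩ := tour_main T hT
  refine ⟨B.dep, W, E', F', i1, i2, i3, X, lab, hX, h1, B.layer, ?_⟩
  rintro u v ⟨-, e, he⟩
  obtain ⟨g, i, hi, -, hs⟩ := edge_corners emb he
  have hi' : (i+1) % (emb.boundary g).len < (emb.boundary g).len := Nat.mod_lt _ (by omega)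
  have hcc : CC emb (cor (g, i) : Item V F) (cor (g, (i+1) % (emb.boundary g).len)) := ⟨g, i, hi, Or.inl ⟨rfl, rfl⟩⟩
  rw [Sym2.eq_iff] at hs
  rcases hs with ⟨e1, e2⟩ | ⟨e1, e2⟩
  · have := h2 _ (hcor g i hi) _ (hcor g _ hi') hcc
    change (lab ((emb.boundary g).vtx i)).1 = (lab ((emb.boundary g).vtx _)).1 ∨ X.M.simple.Adj (lab ((emb.boundary g).vtx i)).1 (lab ((emb.boundary g).vtx _)).1 at this
    rw [e1, e2] at this
    exact this
  · have := h2 _ (hcor g _ hi') _ (hcor g i hi) hcc.symm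
    change (lab ((emb.boundary g).vtx _)).1 = (lab ((emb.boundary g).vtx i)).1 ∨ X.M.simple.Adj (lab ((emb.boundary g).vtx _)).1 (lab ((emb.boundary g).vtx i)).1 at this
    rw [e1, e2] at this
    exact this

theorem final {V : Type} (G : SimpleGraph V) (hG : IsPlanar G) :
    ∃ (W : Type) (H : SimpleGraph W) (n : ℕ),
      IsPlanar H ∧ TreewidthLE H 3 ∧
      G.IsContainedIn
        ((H.strongProd (SimpleGraph.pathGraph n)).strongProd (SimpleGraph.completeGraph (Fin 3))) := by
  classical
  obtain ⟨V', E', F', _, _, _, M, emb, hg, φ, hφ⟩ := hG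
  obtain ⟨dep, W, E1, F1, i1, i2, i3, X, lab, hX, hinj, hlay, hadj⟩ := tour_of_emb emb (by simpa using hg)
  have := Fintype.ofFinite V'
  refine ⟨W, X.M.simple, Finset.univ.sup dep + 1, ts_planar X hX, ts_tw X hX, ?_⟩
  have hlt : ∀ v, dep v < Finset.univ.sup dep + 1 := fun v =>
    Nat.lt_succ_of_le (Finset.le_sup (f := dep) (Finset.mem_univ v))
  let ψ : V' → (W × Fin (Finset.univ.sup dep + 1)) × Fin 3 := fun v => (((lab v).1, ⟨dep v, hlt v⟩), (lab v).2)
  have hψ : Function.Injective ψ := by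
    intro u v h
    simp only [ψ, Prod.mk.injEq, Fin.mk.injEq] at h
    exact hinj u v (Prod.ext h.1.1 h.2) h.1.2
  have hh : ∀ u v, M.simple.Adj u v →
      ((X.M.simple.strongProd (SimpleGraph.pathGraph (Finset.univ.sup dep + 1))).strongProd (SimpleGraph.completeGraph (Fin 3))).Adj (ψ u) (ψ v) := by
    intro u v huv
    refine ⟨fun h => huv.ne (hψ h), ?_, ?_⟩
    · by_cases heq : (ψ u).1 = (ψ v).1
      · exact Or.inl heq
      · right
        refine ⟨heq, hadj u v huv, ?_⟩
        have a1 := hlay u v huv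
        have a2 := hlay v u huv.symm
        show (⟨dep u, hlt u⟩ : Fin _) = ⟨dep v, hlt v⟩ ∨ (SimpleGraph.pathGraph _).Adj ⟨dep u, hlt u⟩ ⟨dep v, hlt v⟩
        rw [SimpleGraph.pathGraph_adj, Fin.mk.injEq]
        show dep u = dep v ∨ dep u + 1 = dep v ∨ dep v + 1 = dep u
        omega
    · by_cases heq : (ψ u).2 = (ψ v).2
      · exact Or.inl heq
      · exact Or.inr heq
  exact ⟨⟨fun v => ψ (φ v), fun {a b} hab => hh _ _ (φ.map_rel hab)⟩, fun a b h => hφ (hψ h)⟩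

end PPS

/-- Planar Graph Product Structure Theorem.
Every planar graph is contained in `H ⊠ P ⊠ K₃` for some planar graph `H` with
treewidth at most 3 and for some path `P`. -/
theorem planar_product_structure {V : Type} (G : SimpleGraph V) (hG : IsPlanar G) :
    ∃ (W : Type) (H : SimpleGraph W) (n : ℕ),
      IsPlanar H ∧ TreewidthLE H 3 ∧
      G.IsContainedIn
        ((H.strongProd (SimpleGraph.pathGraph n)).strongProd (SimpleGraph.completeGraph (Fin 3))) := by
  exact PPS.final G hG
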